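/- arXiv:math/0507488 — 5 statements merged into one kernel-verified Lean document; each statement's English description precedes it below -/
import Mathlib

section
/- Let d, r be integers with 2 ≤ r ≤ d−1. Let A₁,…,A_r and A'₁,…,A'_r be two linearly independent families of binary forms of order d over ℂ, with Wronskian-combinant collections (C_q)_{q∈𝒩_r} and (C'_q)_{q∈𝒩_r} respectively. If there exists λ ∈ ℂ, λ ≠ 0, with C'_q = λ·C_q for all q ∈ 𝒩_r, then the ℂ-linear span of A₁,…,A_r equals the ℂ-linear span of A'₁,…,A'_r. -/
open MvPolynomial Finset

/-- The `k`-th transvectant of binary forms `E, F` of orders `e, f`. -/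
noncomputable def transvectant (e f k : ℕ) (E F : MvPolynomial (Fin 2) ℂ) :
    MvPolynomial (Fin 2) ℂ :=
  ((((e - k).factorial * (f - k).factorial : ℕ) : ℂ) /
      ((e.factorial * f.factorial : ℕ) : ℂ)) •
    ∑ i ∈ Finset.range (k + 1),
      ((-1 : ℂ) ^ i * (k.choose i : ℂ)) •
        ((⇑(pderiv (0 : Fin 2)))^[k - i] ((⇑(pderiv (1 : Fin 2)))^[i] E) *
          (⇑(pderiv (0 : Fin 2)))^[i] ((⇑(pderiv (1 : Fin 2)))^[k - i] F))

/-- The Wronskian of `s` binary forms of order `n`. -/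
noncomputable def wronskian (n : ℕ) {s : ℕ} (F : Fin s → MvPolynomial (Fin 2) ℂ) :
    MvPolynomial (Fin 2) ℂ :=
  (((n - s + 1).factorial : ℂ) / (n.factorial : ℂ)) ^ s •
    Matrix.det (Matrix.of fun i j : Fin s =>
      (⇑(pderiv (0 : Fin 2)))^[s - 1 - (j : ℕ)] ((⇑(pderiv (1 : Fin 2)))^[(j : ℕ)] (F i)))

/-- Remove the `i`-th member from a family indexed by `Fin r`. -/
def removeIdx {α : Sort*} {r : ℕ} (A : Fin r → α) (i : Fin r) : Fin (r - 1) → α :=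
  fun j => A (Fin.cast (Nat.succ_pred_eq_of_pos i.pos)
    (Fin.succAbove (Fin.cast (Nat.succ_pred_eq_of_pos i.pos).symm i) j))

/-- `Γ_p(B; A₁,…,A_r) = Σᵢ (−1)^{i+1} (B,Aᵢ)_p · W(A₁,…,Âᵢ,…,A_r)`,
where `B` has order `n` and the `Aᵢ` have order `d`. -/
noncomputable def gammaTransvectant (d n p : ℕ) {r : ℕ}
    (B : MvPolynomial (Fin 2) ℂ) (A : Fin r → MvPolynomial (Fin 2) ℂ) :
    MvPolynomial (Fin 2) ℂ :=
  ∑ i : Fin r, (-1 : ℂ) ^ (i : ℕ) •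
    (transvectant n d p B (A i) * wronskian d (removeIdx A i))

/-- The index set `𝒩_r = {q : 0 ≤ q ≤ r, q ≠ 1}`. -/
def Nset (r : ℕ) : Finset ℕ := (Finset.range (r + 1)).filter (· ≠ 1)

/-- A Wronskian-combinant collection for binary forms `A₁,…,A_r` of order `d`:
forms `C_q` of order `r(d−r+1)−2q` for `q ∈ 𝒩_r` with
`W(A₁,…,A_r,F) = Σ_q (C_q,F)_{r−q}` for all forms `F` of order `d`. -/
def IsWronskianCombinantCollection (d r : ℕ)
    (A : Fin r → MvPolynomial (Fin 2) ℂ) (C : ℕ → MvPolynomial (Fin 2) ℂ) : Prop :=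
  (∀ q ∈ Nset r, (C q).IsHomogeneous (r * (d - r + 1) - 2 * q)) ∧
  ∀ F : MvPolynomial (Fin 2) ℂ, F.IsHomogeneous d →
    wronskian d (Fin.snoc A F) =
      ∑ q ∈ Nset r, transvectant (r * (d - r + 1) - 2 * q) d (r - q) (C q) F


theorem Polynomial.coeff_prod_sum_of_natDegree_le {R ι : Type*} [CommSemiring R] (s : Finset ι)
    (f : ι → Polynomial R) (k : ι → ℕ) (h : ∀ i ∈ s, (f i).natDegree ≤ k i) :
    (∏ i ∈ s, f i).coeff (∑ i ∈ s, k i) = ∏ i ∈ s, (f i).coeff (k i) := by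
  classical
  induction s using Finset.induction_on with
  | empty => simp
  | insert a s ha ih =>
    have hs : ∀ i ∈ s, (f i).natDegree ≤ k i := fun i hi => h i (mem_insert_of_mem hi)
    rw [prod_insert ha, sum_insert ha, prod_insert ha,
      Polynomial.coeff_mul_add_eq_of_natDegree_le (h a (mem_insert_self a s))
        ((Polynomial.natDegree_prod_le s f).trans (sum_le_sum hs)), ih hs]

theorem Matrix.coeff_det_of_natDegree_le {R n : Type*} [CommRing R] [Fintype n] [DecidableEq n]
    (M : Matrix n n (Polynomial R)) (k : n → ℕ) (h : ∀ i j, (M i j).natDegree ≤ k i) :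
    M.det.coeff (∑ i, k i) = (Matrix.of fun i j => (M i j).coeff (k i)).det := by
  rw [← Matrix.det_transpose M, ← Matrix.det_transpose (Matrix.of _), Matrix.det_apply,
    Matrix.det_apply, Polynomial.finsetSum_coeff]
  refine sum_congr rfl fun σ _ => ?_
  simp only [Units.smul_def, Polynomial.coeff_smul, Matrix.transpose_apply, Matrix.of_apply]
  rw [← Polynomial.coeff_prod_sum_of_natDegree_le univ (fun i => M i (σ i)) k fun i _ => h i _]

/-- Triangularity at the points `0, …, s - 1` makes a family of `s` polynomials of degree less
than `s` unisolvent. -/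
theorem det_eval_ne_zero_of_triangular {s : ℕ} (p : Fin s → Polynomial ℂ)
    (hdeg : ∀ j, (p j).natDegree < s)
    (hlt : ∀ m j : Fin s, m < j → (p j).eval (m : ℂ) = 0)
    (hdiag : ∀ m : Fin s, (p m).eval (m : ℂ) ≠ 0)
    (x : Fin s → ℂ) (hx : Function.Injective x) :
    (Matrix.of fun i j => (p j).eval (x i)).det ≠ 0 := by
  intro h0
  obtain ⟨a, ha, hMa⟩ := Matrix.exists_mulVec_eq_zero_iff.2 h0
  apply ha
  have hq : ∑ j, Polynomial.C (a j) * p j = 0 := by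
    rcases Nat.eq_zero_or_pos s with rfl | hs
    · simp
    refine Polynomial.eq_zero_of_natDegree_lt_card_of_eval_eq_zero _ hx (fun i => ?_) ?_
    · have := congrFun hMa i
      simpa [Matrix.mulVec, dotProduct, Polynomial.eval_finsetSum, mul_comm] using this
    · rw [Fintype.card_fin]
      refine lt_of_le_of_lt (Polynomial.natDegree_sum_le_of_forall_le (n := s - 1) _ _ fun j _ => ?_)
        (Nat.sub_lt hs one_pos)
      exact (Polynomial.natDegree_C_mul_le _ _).trans (Nat.le_sub_one_of_lt (hdeg j))
  have key : ∀ m : Fin s, a m = 0 := by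
    intro m
    induction m using WellFoundedLT.induction with
    | _ m ih =>
      have h := congrArg (Polynomial.eval (m : ℂ)) hq
      rw [Polynomial.eval_finsetSum, sum_eq_single m] at h
      · simpa [hdiag m] using h
      · intro j _ hj
        rcases lt_or_gt_of_ne hj with hj | hj
        · simp [ih j hj]
        · simp [hlt m j hj]
      · simp
  exact funext key

theorem det_descFactorial_ne_zero {d s : ℕ} (hs : s ≤ d + 1) (k : Fin s → ℕ)
    (hk : Function.Injective k) (hkd : ∀ i, k i ≤ d) :
    (Matrix.of fun i j : Fin s =>
      ((d - k i).descFactorial (s - 1 - j) * (k i).descFactorial j : ℂ)).det ≠ 0 := by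
  let p : Fin s → Polynomial ℂ := fun j =>
    (descPochhammer ℂ (s - 1 - j)).comp (Polynomial.C (d : ℂ) - Polynomial.X) *
      descPochhammer ℂ j
  have hp : ∀ (j : Fin s) (m : ℕ), m ≤ d → (p j).eval (m : ℂ) =
      ((d - m).descFactorial (s - 1 - j) * m.descFactorial j : ℂ) := by
    intro j m hm
    simp only [p, Polynomial.eval_mul, Polynomial.eval_comp, Polynomial.eval_sub,
      Polynomial.eval_C, Polynomial.eval_X]
    rw [← Nat.cast_sub hm, descPochhammer_eval_eq_descFactorial,
      descPochhammer_eval_eq_descFactorial]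
  have h := det_eval_ne_zero_of_triangular p (fun j => ?_) (fun m j hmj => ?_) (fun m => ?_)
    (fun i => (k i : ℂ)) (Nat.cast_injective.comp hk)
  · simpa only [hp _ _ (hkd _)] using h
  · have h1 : (Polynomial.C (d : ℂ) - Polynomial.X).natDegree ≤ 1 :=
      (Polynomial.natDegree_sub_le _ _).trans (by simp)
    have h2 : (p j).natDegree ≤ (s - 1 - j) * 1 + j := by
      refine Polynomial.natDegree_mul_le.trans (add_le_add ?_ (descPochhammer_natDegree ℂ j).le)
      refine Polynomial.natDegree_comp_le.trans ?_
      rw [descPochhammer_natDegree]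
      gcongr
    have := j.2
    omega
  · rw [hp _ _ (by omega), Nat.descFactorial_of_lt hmj]
    simp
  · have := m.2
    rw [hp _ _ (by omega), ← Nat.cast_mul, Nat.cast_ne_zero]
    refine mul_ne_zero ?_ ?_ <;> rw [Ne, Nat.descFactorial_eq_zero_iff_lt] <;> omega

theorem LinearIndependent.update_sub_smul {K V ι : Type*} [Field K] [AddCommGroup V] [Module K V]
    [DecidableEq ι] {f : ι → V} (hf : LinearIndependent K f) {i j : ι} (hij : i ≠ j) (c : K) :
    LinearIndependent K (Function.update f i (f i + c • f j)) := by
  refine hf.update i _ ⟨1, one_mem _, Finsupp.single i 1 + Finsupp.single j c, ?_, ?_⟩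
  · simp [hij]
  · simp

/-- A determinant whose `(i, j)` entry is obtained from a polynomial `f i` by a diagonal operator
with eigenvalues `P j` does not vanish, provided that `f` is linearly independent and the
generalized Vandermonde determinants of `P` do not vanish. -/
theorem det_diagonal_operators_ne_zero {K : Type*} [Field K] {d s : ℕ} (P : Fin s → ℕ → K)
    (hP : ∀ k : Fin s → ℕ, Function.Injective k → (∀ i, k i ≤ d) →
      (Matrix.of fun i j => P j (k i)).det ≠ 0)
    (f : Fin s → Polynomial K) (hf : LinearIndependent K f) (hd : ∀ i, (f i).natDegree ≤ d)
    (M : Matrix (Fin s) (Fin s) (Polynomial K))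
    (hM : ∀ i j n, (M i j).coeff n = P j n * (f i).coeff n) : M.det ≠ 0 := by
  induction hN : ∑ i, (f i).natDegree using Nat.strong_induction_on generalizing f M with
  | _ N ih =>
  by_cases hinj : Function.Injective fun i => (f i).natDegree
  · intro h0
    have hdeg : ∀ i j, (M i j).natDegree ≤ (f i).natDegree := fun i j => by
      rw [Polynomial.natDegree_le_iff_coeff_eq_zero]
      intro n hn
      rw [hM, Polynomial.coeff_eq_zero_of_natDegree_lt hn, mul_zero]
    have h := Matrix.coeff_det_of_natDegree_le M _ hdeg
    have hrw : (Matrix.of fun i j => (M i j).coeff (f i).natDegree) =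
        Matrix.of fun i j => (f i).leadingCoeff *
          (Matrix.of fun i j => P j (f i).natDegree) i j := by
      ext i j
      simp [hM, mul_comm]
    rw [h0, Polynomial.coeff_zero, hrw, Matrix.det_mul_column] at h
    refine mul_ne_zero (prod_ne_zero_iff.2 fun i _ => ?_) (hP _ hinj hd) h.symm
    exact Polynomial.leadingCoeff_ne_zero.2 (hf.ne_zero i)
  · simp only [Function.Injective, not_forall] at hinj
    obtain ⟨i, j, hdij, hij⟩ := hinj
    set c : K := -((f i).leadingCoeff / (f j).leadingCoeff) with hc
    set g := Function.update f i (f i + c • f j) with hg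
    have hgind : LinearIndependent K g := hf.update_sub_smul hij c
    have hlj : (f j).leadingCoeff ≠ 0 := Polynomial.leadingCoeff_ne_zero.2 (hf.ne_zero j)
    have hgi : (g i).natDegree < (f i).natDegree := by
      refine Polynomial.natDegree_lt_natDegree (hgind.ne_zero i) ?_
      rw [hg, Function.update_self, hc, neg_smul, ← sub_eq_add_neg]
      have hc0 : (f i).leadingCoeff / (f j).leadingCoeff ≠ 0 :=
        div_ne_zero (Polynomial.leadingCoeff_ne_zero.2 (hf.ne_zero i)) hlj
      refine Polynomial.degree_sub_lt_left ?_ (hf.ne_zero i) ?_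
      · rw [Polynomial.degree_smul_of_smul_regular _ (IsSMulRegular.of_ne_zero hc0),
          Polynomial.degree_eq_natDegree (hf.ne_zero i),
          Polynomial.degree_eq_natDegree (hf.ne_zero j), hdij]
      · rw [Polynomial.smul_eq_C_mul, Polynomial.leadingCoeff_mul, Polynomial.leadingCoeff_C,
          div_mul_cancel₀ _ hlj]
    have hgl : ∀ l, l ≠ i → g l = f l := fun l hl => Function.update_of_ne hl _ _
    have hgle : ∀ l, (g l).natDegree ≤ (f l).natDegree := fun l => by
      rcases eq_or_ne l i with rfl | hl
      · exact hgi.le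
      · rw [hgl l hl]
    have := ih _ (hN ▸ sum_lt_sum (fun l _ => hgle l) ⟨i, mem_univ i, hgi⟩) g hgind
      (fun l => (hgle l).trans (hd l)) (M.updateRow i (M i + Polynomial.C c • M j))
      (fun l m n => ?_) rfl
    · rwa [Matrix.det_updateRow_add_smul_self M hij] at this
    · rcases eq_or_ne l i with rfl | hl
      · rw [hg, Function.update_self, Matrix.updateRow_self]
        simp [hM, mul_add, mul_left_comm]
      · rw [hgl l hl, Matrix.updateRow_ne hl, hM]

theorem pderiv_iterate_monomial (a b p q : ℕ) :
    (⇑(pderiv (0 : Fin 2)))^[a] ((⇑(pderiv (1 : Fin 2)))^[b]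
      (X 0 ^ p * X 1 ^ q : MvPolynomial (Fin 2) ℂ)) =
      C ((p.descFactorial a * q.descFactorial b : ℕ) : ℂ) * (X 0 ^ (p - a) * X 1 ^ (q - b)) := by
  have h1 : ∀ b, (⇑(pderiv (1 : Fin 2)))^[b] (X 0 ^ p * X 1 ^ q : MvPolynomial (Fin 2) ℂ) =
      C ((q.descFactorial b : ℕ) : ℂ) * (X 0 ^ p * X 1 ^ (q - b)) := by
    intro b
    induction b with
    | zero => simp
    | succ b ih =>
      rw [Function.iterate_succ_apply', ih]
      simp [Nat.descFactorial_succ, Nat.sub_sub]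
      ring
  induction a with
  | zero => simp [h1]
  | succ a ih =>
    rw [Function.iterate_succ_apply', ih]
    simp [Nat.descFactorial_succ, Nat.sub_sub]
    ring

theorem binaryForm_induction {d : ℕ} {motive : MvPolynomial (Fin 2) ℂ → Prop}
    (monomial : ∀ p q, p + q = d → motive (X 0 ^ p * X 1 ^ q))
    (zero : motive 0) (add : ∀ F G, motive F → motive G → motive (F + G))
    (smul : ∀ (c : ℂ) F, motive F → motive (c • F))
    {F : MvPolynomial (Fin 2) ℂ} (hF : F.IsHomogeneous d) : motive F := by
  rw [F.as_sum]
  refine Finset.sum_induction _ motive add zero fun m hm => ?_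
  have hmd : m 0 + m 1 = d := by
    have := hF (mem_support_iff.1 hm)
    simpa [Finsupp.weight_apply, Finsupp.sum_fintype] using this
  have h := smul (coeff m F) _ (monomial _ _ hmd)
  rwa [smul_eq_C_mul, ← Fin.prod_univ_two (fun i => (X i : MvPolynomial (Fin 2) ℂ) ^ m i),
    ← Finsupp.prod_fintype m (fun i e => (X i : MvPolynomial (Fin 2) ℂ) ^ e) (by simp),
    ← monomial_eq] at h

/-- Dehomogenization of a binary form at `x₁ = 1`. -/
noncomputable def dehomogenize : MvPolynomial (Fin 2) ℂ →ₐ[ℂ] Polynomial ℂ :=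
  aeval ![1, Polynomial.X]

theorem natDegree_dehomogenize_le {d : ℕ} {F : MvPolynomial (Fin 2) ℂ} (hF : F.IsHomogeneous d) :
    (dehomogenize F).natDegree ≤ d := by
  refine binaryForm_induction (motive := fun F => (dehomogenize F).natDegree ≤ d)
    (fun p q hpq => ?_) (by simp) (fun F G hF hG => ?_) (fun c F hF => ?_) hF
  · simp [dehomogenize]; omega
  · rw [map_add]; exact Polynomial.natDegree_add_le_of_degree_le hF hG
  · rw [map_smul]; exact (Polynomial.natDegree_smul_le _ _).trans hF

theorem eq_sum_coeff_dehomogenize {d : ℕ} {F : MvPolynomial (Fin 2) ℂ} (hF : F.IsHomogeneous d) :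
    F = ∑ k ∈ range (d + 1), (dehomogenize F).coeff k • (X 0 ^ (d - k) * X 1 ^ k) := by
  refine binaryForm_induction (motive := fun F =>
    F = ∑ k ∈ range (d + 1), (dehomogenize F).coeff k • (X 0 ^ (d - k) * X 1 ^ k))
    (fun p q hpq => ?_) (by simp) (fun F G hF hG => ?_) (fun c F hF => ?_) hF
  · rw [sum_eq_single q]
    · simp [dehomogenize, ← hpq]
    · intro k _ hk
      simp [dehomogenize, Polynomial.coeff_X_pow, hk]
    · simp; omega
  · simp only [map_add, Polynomial.coeff_add, add_smul, sum_add_distrib, ← hF, ← hG]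
  · simp only [map_smul, Polynomial.coeff_smul, smul_assoc, ← smul_sum, ← hF]

theorem pderiv_iterate_smul (k : ℕ) (i : Fin 2) (c : ℂ) (F : MvPolynomial (Fin 2) ℂ) :
    (⇑(pderiv i))^[k] (c • F) = c • (⇑(pderiv i))^[k] F :=
  Function.Commute.iterate_left (g := fun G => c • G) (fun G => (pderiv i).map_smul c G) k F

theorem coeff_X_pow_mul_dehomogenize_pderiv {d : ℕ} {F : MvPolynomial (Fin 2) ℂ}
    (hF : F.IsHomogeneous d) (a b n : ℕ) :
    (Polynomial.X ^ b * dehomogenize ((⇑(pderiv (0 : Fin 2)))^[a]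
      ((⇑(pderiv (1 : Fin 2)))^[b] F))).coeff n =
      ((d - n).descFactorial a * n.descFactorial b : ℂ) * (dehomogenize F).coeff n := by
  refine binaryForm_induction (motive := fun F =>
    (Polynomial.X ^ b * dehomogenize ((⇑(pderiv (0 : Fin 2)))^[a]
      ((⇑(pderiv (1 : Fin 2)))^[b] F))).coeff n =
      ((d - n).descFactorial a * n.descFactorial b : ℂ) * (dehomogenize F).coeff n)
    (fun p q hpq => ?_) (by simp) (fun F G hF hG => ?_) (fun c F hF => ?_) hF
  · rw [pderiv_iterate_monomial]
    simp only [dehomogenize, map_mul, map_pow, aeval_X, algHom_C, Matrix.cons_val_zero,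
      Matrix.cons_val_one, one_pow, one_mul, Polynomial.algebraMap_eq]
    rw [mul_left_comm, ← pow_add, Polynomial.coeff_C_mul, Polynomial.coeff_X_pow,
      Polynomial.coeff_X_pow]
    rcases lt_or_ge q b with hqb | hqb
    · rw [Nat.descFactorial_of_lt hqb]
      by_cases hn : n = q
      · simp [hn, Nat.descFactorial_of_lt hqb]
      · simp [hn]
    · rw [Nat.add_sub_cancel' hqb]
      by_cases hn : n = q
      · simp [hn, ← hpq]
      · simp [hn]
  · simp only [iterate_map_add, map_add, mul_add, Polynomial.coeff_add, hF, hG]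
  · rw [pderiv_iterate_smul, pderiv_iterate_smul, map_smul, map_smul, mul_smul_comm,
      Polynomial.coeff_smul, hF, Polynomial.coeff_smul, smul_eq_mul, smul_eq_mul, mul_left_comm]

theorem linearIndependent_dehomogenize {ι : Type*} {d : ℕ} {F : ι → MvPolynomial (Fin 2) ℂ}
    (hF : ∀ i, (F i).IsHomogeneous d) (hind : LinearIndependent ℂ F) :
    LinearIndependent ℂ fun i => dehomogenize (F i) := by
  have hdisj : Disjoint (Submodule.span ℂ (Set.range F))
      (LinearMap.ker dehomogenize.toLinearMap) := by
    rw [Submodule.disjoint_def]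
    intro G hG h0
    have hGd : G.IsHomogeneous d := by
      have : Submodule.span ℂ (Set.range F) ≤ homogeneousSubmodule (Fin 2) ℂ d :=
        Submodule.span_le.2 (Set.range_subset_iff.2 hF)
      exact this hG
    have h0' : dehomogenize G = 0 := h0
    have h := eq_sum_coeff_dehomogenize hGd
    simpa [h0'] using h
  exact hind.map (f := dehomogenize.toLinearMap) hdisj

/-- The Wronskian of linearly independent binary forms does not vanish. -/
theorem wronskian_ne_zero {d s : ℕ} (hs : s ≤ d + 1) {F : Fin s → MvPolynomial (Fin 2) ℂ}
    (hF : ∀ i, (F i).IsHomogeneous d) (hind : LinearIndependent ℂ F) : wronskian d F ≠ 0 := by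
  unfold wronskian
  refine smul_ne_zero (pow_ne_zero _ (div_ne_zero ?_ ?_)) fun h0 => ?_
  · exact Nat.cast_ne_zero.2 (Nat.factorial_ne_zero _)
  · exact Nat.cast_ne_zero.2 (Nat.factorial_ne_zero _)
  have h := congrArg dehomogenize h0
  rw [map_zero, AlgHom.map_det] at h
  refine det_diagonal_operators_ne_zero (d := d)
    (fun (j : Fin s) k => ((d - k).descFactorial (s - 1 - j) * k.descFactorial j : ℂ))
    (fun k hk hkd => det_descFactorial_ne_zero hs k hk hkd) _
    (linearIndependent_dehomogenize hF hind) (fun i => natDegree_dehomogenize_le (hF i))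
    (Matrix.of fun i j => (fun j : Fin s => Polynomial.X ^ (j : ℕ)) j * dehomogenize.mapMatrix
      (Matrix.of fun i j : Fin s => (⇑(pderiv (0 : Fin 2)))^[s - 1 - (j : ℕ)]
        ((⇑(pderiv (1 : Fin 2)))^[(j : ℕ)] (F i))) i j)
    (fun i j n => coeff_X_pow_mul_dehomogenize_pderiv (hF i) _ _ n) ?_
  rw [Matrix.det_mul_row, h, mul_zero]

theorem wronskian_eq_zero_of_eq {d s : ℕ} {F : Fin s → MvPolynomial (Fin 2) ℂ} {i j : Fin s}
    (hij : i ≠ j) (h : F i = F j) : wronskian d F = 0 := by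
  unfold wronskian
  rw [Matrix.det_zero_of_row_eq hij (by ext; simp [h]), smul_zero]

theorem mem_span_of_wronskian_snoc_eq_zero {d r : ℕ} (hrd : r ≤ d)
    {A : Fin r → MvPolynomial (Fin 2) ℂ} (hA : ∀ i, (A i).IsHomogeneous d)
    (hind : LinearIndependent ℂ A) {F : MvPolynomial (Fin 2) ℂ} (hF : F.IsHomogeneous d)
    (h : wronskian d (Fin.snoc A F : Fin (r + 1) → MvPolynomial (Fin 2) ℂ) = 0) :
    F ∈ Submodule.span ℂ (Set.range A) := by
  by_contra hmem
  refine wronskian_ne_zero (Nat.succ_le_succ hrd) (fun i => ?_) (hind.finSnoc hmem) h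
  induction i using Fin.lastCases with
  | last => simpa using hF
  | cast i => simpa using hA i

theorem transvectant_smul_left (e f k : ℕ) (c : ℂ) (E F : MvPolynomial (Fin 2) ℂ) :
    transvectant e f k (c • E) F = c • transvectant e f k E F := by
  simp only [transvectant, pderiv_iterate_smul, smul_mul_assoc, smul_sum, smul_comm _ c]

/-- two linearly independent families of binary forms of order `d`
whose Wronskian-combinant collections are proportional by a nonzero constant
have the same `ℂ`-linear span. -/
theorem span_eq_of_proportional_combinants (d r : ℕ) (hr2 : 2 ≤ r) (hrd : r ≤ d - 1)
    (A A' : Fin r → MvPolynomial (Fin 2) ℂ)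
    (hA : ∀ i, (A i).IsHomogeneous d) (hA' : ∀ i, (A' i).IsHomogeneous d)
    (hind : LinearIndependent ℂ A) (hind' : LinearIndependent ℂ A')
    (C C' : ℕ → MvPolynomial (Fin 2) ℂ)
    (hC : IsWronskianCombinantCollection d r A C)
    (hC' : IsWronskianCombinantCollection d r A' C')
    (lam : ℂ) (hlam : lam ≠ 0) (hprop : ∀ q ∈ Nset r, C' q = lam • C q) :
    Submodule.span ℂ (Set.range A) = Submodule.span ℂ (Set.range A') := by
  have hW : ∀ F : MvPolynomial (Fin 2) ℂ, F.IsHomogeneous d →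
      wronskian d (Fin.snoc A' F : Fin (r + 1) → MvPolynomial (Fin 2) ℂ) =
        lam • wronskian d (Fin.snoc A F : Fin (r + 1) → MvPolynomial (Fin 2) ℂ) := by
    intro F hF
    rw [hC.2 F hF, hC'.2 F hF, smul_sum]
    exact sum_congr rfl fun q hq => by rw [hprop q hq, transvectant_smul_left]
  have hle : Submodule.span ℂ (Set.range A') ≤ Submodule.span ℂ (Set.range A) := by
    refine Submodule.span_le.2 (Set.range_subset_iff.2 fun i => ?_)
    refine mem_span_of_wronskian_snoc_eq_zero (by omega) hA hind (hA' i) ?_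
    refine (smul_eq_zero_iff_right hlam).1 ?_
    rw [← hW _ (hA' i)]
    exact wronskian_eq_zero_of_eq (Fin.castSucc_ne_last i) (by simp)
  have : FiniteDimensional ℂ (Submodule.span ℂ (Set.range A)) :=
    FiniteDimensional.span_of_finite ℂ (Set.finite_range A)
  refine (Submodule.eq_of_le_of_finrank_eq hle ?_).symm
  rw [finrank_span_eq_card hind', finrank_span_eq_card hind]
end

section
/- Let d, r be integers with 2 ≤ r ≤ d−1, and let (E_q)_{q∈𝒩_r} be a family of binary forms over ℂ with E_q of order r(d−r+1)−2q, not all zero. Then the following are equivalent: (i) the ℂ-vector space of binary forms F of order d satisfying Σ_{q∈𝒩_r} (E_q, F)_{r−q} = 0 has dimension at least r; (ii) there exist linearly independent binary forms A₁,…,A_r of order d and a constant k ∈ ℂ, k ≠ 0, such that Σ_{q∈𝒩_r} (E_q, F)_{r−q} = k·W(A₁,…,A_r,F) for every binary form F of order d. -/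
open MvPolynomial Finset

section TransvectantProcess

open TensorProduct

variable {M : Type*} [AddCommGroup M] [Module ℂ M]

/-- The binomial expansion of a power of Cayley's operator built from commuting `P` and `Q`. -/
lemma omega_pow {P Q : Module.End ℂ M} (h : Commute P Q) (k : ℕ) :
    (TensorProduct.map P Q - TensorProduct.map Q P : Module.End ℂ (M ⊗[ℂ] M)) ^ k =
      ∑ i ∈ range (k + 1), ((-1 : ℂ) ^ i * (k.choose i : ℂ)) •
        TensorProduct.map (P ^ (k - i) * Q ^ i) (P ^ i * Q ^ (k - i)) := by
  have hc : Commute (-TensorProduct.map Q P : Module.End ℂ (M ⊗[ℂ] M))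
      (TensorProduct.map P Q) := by
    refine Commute.neg_left (R := Module.End ℂ (M ⊗[ℂ] M)) ?_
    change (TensorProduct.map Q P : Module.End ℂ (M ⊗[ℂ] M)) * TensorProduct.map P Q =
      TensorProduct.map P Q * TensorProduct.map Q P
    rw [← TensorProduct.map_mul, ← TensorProduct.map_mul, h.eq]
  rw [sub_eq_neg_add, hc.add_pow]
  refine sum_congr rfl fun i _ => ?_
  rw [neg_pow (R := Module.End ℂ (M ⊗[ℂ] M)), TensorProduct.map_pow,
    TensorProduct.map_pow, mul_assoc ((-1) ^ i),
    ← TensorProduct.map_mul, (h.pow_pow (k - i) i).eq, mul_smul]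
  rw [← nsmul_eq_mul', ← Nat.cast_smul_eq_nsmul ℂ]
  rcases Nat.even_or_odd i with hi | hi <;> simp [hi.neg_one_pow]

/-- The transvectant sum is unchanged when `Q` is replaced by `Q + z P`. -/
lemma sum_omega_eq_of_shear {P Q : Module.End ℂ M} (h : Commute P Q) (z : ℂ) (k : ℕ)
    (μ : M →ₗ[ℂ] M →ₗ[ℂ] M) (E F : M) :
    ∑ i ∈ range (k + 1), ((-1 : ℂ) ^ i * (k.choose i : ℂ)) •
        μ ((P ^ (k - i) * Q ^ i) E) ((P ^ i * Q ^ (k - i)) F) =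
      ∑ i ∈ range (k + 1), ((-1 : ℂ) ^ i * (k.choose i : ℂ)) •
        μ ((P ^ (k - i) * (Q + z • P) ^ i) E) ((P ^ i * (Q + z • P) ^ (k - i)) F) := by
  have h' : Commute P (Q + z • P) := h.add_right ((Commute.refl P).smul_right z)
  have key := omega_pow h k
  have hΩ : (TensorProduct.map P (Q + z • P) - TensorProduct.map (Q + z • P) P :
      Module.End ℂ (M ⊗[ℂ] M)) = TensorProduct.map P Q - TensorProduct.map Q P := by
    simp [TensorProduct.map_add_left, TensorProduct.map_add_right,
      TensorProduct.map_smul_left, TensorProduct.map_smul_right]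
  rw [← hΩ, omega_pow h' k] at key
  have := congrArg (fun T : Module.End ℂ (M ⊗[ℂ] M) => TensorProduct.lift μ (T (E ⊗ₜ F))) key
  simpa using this.symm

end TransvectantProcess

section Dehomogenization

/-- Substituting `x₁ = X`, `x₂ = 1` in a binary form. -/
noncomputable def dehom : MvPolynomial (Fin 2) ℂ →ₐ[ℂ] Polynomial ℂ :=
  aeval ![Polynomial.X, 1]

lemma eval_dehom (F : MvPolynomial (Fin 2) ℂ) (z : ℂ) :
    (dehom F).eval z = MvPolynomial.eval ![z, 1] F := by
  rw [dehom, ← Polynomial.coe_evalRingHom, aeval_def, MvPolynomial.hom_eval₂,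
    MvPolynomial.eval, MvPolynomial.coe_eval₂Hom]
  congr 1
  · ext; simp
  · ext i; fin_cases i <;> simp

lemma dehom_pderiv (F : MvPolynomial (Fin 2) ℂ) :
    dehom (pderiv 0 F) = Polynomial.derivative (dehom F) := by
  induction F using MvPolynomial.induction_on with
  | C a => simp [dehom]
  | add p q hp hq => simp [hp, hq]
  | mul_X p i hp =>
    rw [Derivation.leibniz]
    fin_cases i <;> simpa [dehom, pderiv_X, mul_comm] using hp

lemma dehom_iterate_pderiv (k : ℕ) (F : MvPolynomial (Fin 2) ℂ) :
    dehom ((⇑(pderiv (0 : Fin 2)))^[k] F) = Polynomial.derivative^[k] (dehom F) := by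
  induction k generalizing F with
  | zero => rfl
  | succ k ih => rw [Function.iterate_succ_apply, ih, dehom_pderiv, Function.iterate_succ_apply]

lemma eval_smul_of_isHomogeneous {n : ℕ} {F : MvPolynomial (Fin 2) ℂ} (hF : F.IsHomogeneous n)
    (c : ℂ) (x : Fin 2 → ℂ) :
    MvPolynomial.eval (fun i => c * x i) F = c ^ n * MvPolynomial.eval x F := by
  rw [MvPolynomial.eval_eq, MvPolynomial.eval_eq, mul_sum]
  refine sum_congr rfl fun m hm => ?_
  have hdeg := hF.degree_eq_sum_deg_support hm
  simp_rw [mul_pow, prod_mul_distrib]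
  rw [prod_pow_eq_pow_sum]
  have : ∑ i ∈ m.support, m i = n := by simpa [Finsupp.degree] using hdeg.symm
  rw [this]
  ring

lemma eq_zero_of_dehom_eq_zero {n : ℕ} {F : MvPolynomial (Fin 2) ℂ} (hF : F.IsHomogeneous n)
    (h : dehom F = 0) : F = 0 := by
  have hX : X 1 * F = 0 := by
    refine MvPolynomial.funext fun x => ?_
    rw [map_mul, eval_X, map_zero]
    by_cases hx : x 1 = 0
    · rw [hx, zero_mul]
    · have h1 := eval_smul_of_isHomogeneous hF (x 1) ![x 0 / x 1, 1]
      have h2 : (fun i => x 1 * ![x 0 / x 1, 1] i) = x := by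
        ext i; fin_cases i <;> simp [mul_div_cancel₀, hx]
      rw [h2, ← eval_dehom, h] at h1
      rw [h1]
      simp
  exact (mul_eq_zero.mp hX).resolve_left (X_ne_zero 1)

lemma isHomogeneous_iterate_pderiv {n : ℕ} {F : MvPolynomial (Fin 2) ℂ} (hF : F.IsHomogeneous n)
    (i : Fin 2) (k : ℕ) : ((⇑(pderiv i))^[k] F).IsHomogeneous (n - k) := by
  induction k with
  | zero => simpa
  | succ k ih =>
    rw [Function.iterate_succ_apply', ← Nat.sub_sub]
    exact ih.pderiv

/-- The two partial derivatives as commuting endomorphisms. -/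
noncomputable abbrev pd (i : Fin 2) : Module.End ℂ (MvPolynomial (Fin 2) ℂ) :=
  (pderiv i : Derivation ℂ _ _).toLinearMap

lemma commute_pd : Commute (pd 0) (pd 1) := by
  refine LinearMap.ext fun F => ?_
  change pderiv 0 (pderiv 1 F) = pderiv 1 (pderiv 0 F)
  induction F using MvPolynomial.induction_on with
  | C a => simp
  | add p q hp hq => simp [hp, hq]
  | mul_X p i hp =>
    fin_cases i <;> simp [Derivation.leibniz, hp, pderiv_X, add_comm]

lemma pd_pow_apply (i : Fin 2) (k : ℕ) (F : MvPolynomial (Fin 2) ℂ) :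
    (pd i ^ k) F = (⇑(pderiv i))^[k] F := by
  rw [Module.End.pow_apply]; rfl

lemma isHomogeneous_shear {n : ℕ} {F : MvPolynomial (Fin 2) ℂ} (hF : F.IsHomogeneous n)
    (z : ℂ) : ((pd 1 + z • pd 0) F).IsHomogeneous (n - 1) := by
  rw [LinearMap.add_apply, LinearMap.smul_apply, smul_eq_C_mul]
  exact IsHomogeneous.add hF.pderiv (IsHomogeneous.C_mul hF.pderiv z)

lemma eval_shear {n : ℕ} {F : MvPolynomial (Fin 2) ℂ} (hF : F.IsHomogeneous n) (z : ℂ) :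
    MvPolynomial.eval ![z, 1] ((pd 1 + z • pd 0) F) = n * MvPolynomial.eval ![z, 1] F := by
  have := congrArg (MvPolynomial.eval ![z, 1]) hF.sum_X_mul_pderiv
  simp only [Fin.sum_univ_two, map_add, map_mul, eval_X, nsmul_eq_mul, map_natCast] at this
  rw [← this, LinearMap.add_apply, LinearMap.smul_apply, map_add, MvPolynomial.smul_eval]
  simp [add_comm]

lemma eval_shear_pow {n : ℕ} {F : MvPolynomial (Fin 2) ℂ} (hF : F.IsHomogeneous n) (z : ℂ)
    (b : ℕ) :
    MvPolynomial.eval ![z, 1] (((pd 1 + z • pd 0) ^ b) F) =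
      n.descFactorial b * MvPolynomial.eval ![z, 1] F := by
  induction b generalizing n F with
  | zero => simp
  | succ b ih =>
    rw [pow_succ, Module.End.mul_apply, ih (isHomogeneous_shear hF z), eval_shear hF z]
    cases n with
    | zero => simp
    | succ n => rw [Nat.succ_descFactorial_succ]; push_cast [Nat.add_sub_cancel]; ring

lemma eval_pd_pow_mul_shear_pow {n : ℕ} {F : MvPolynomial (Fin 2) ℂ} (hF : F.IsHomogeneous n)
    (z : ℂ) (a b : ℕ) :
    MvPolynomial.eval ![z, 1] ((pd 0 ^ a * (pd 1 + z • pd 0) ^ b) F) =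
      (n - a).descFactorial b * (Polynomial.derivative^[a] (dehom F)).eval z := by
  have hc : Commute (pd 0) (pd 1 + z • pd 0) :=
    commute_pd.add_right ((Commute.refl _).smul_right z)
  rw [(hc.pow_pow a b).eq, Module.End.mul_apply, pd_pow_apply,
    eval_shear_pow (isHomogeneous_iterate_pderiv hF 0 a), ← dehom_iterate_pderiv, eval_dehom]

lemma eval_dehom_transvectant {e f : ℕ} {E F : MvPolynomial (Fin 2) ℂ}
    (hE : E.IsHomogeneous e) (hF : F.IsHomogeneous f) (k : ℕ) (z : ℂ) :
    (dehom (transvectant e f k E F)).eval z =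
      ((((e - k).factorial * (f - k).factorial : ℕ) : ℂ) /
          ((e.factorial * f.factorial : ℕ) : ℂ)) *
        ∑ i ∈ range (k + 1), ((-1 : ℂ) ^ i * (k.choose i : ℂ)) *
          (((e - (k - i)).descFactorial i *
              (Polynomial.derivative^[k - i] (dehom E)).eval z) *
            ((f - i).descFactorial (k - i) *
              (Polynomial.derivative^[i] (dehom F)).eval z)) := by
  rw [eval_dehom, transvectant, MvPolynomial.smul_eval]
  congr 1
  have key := sum_omega_eq_of_shear commute_pd z k (LinearMap.mul ℂ _) E F
  simp only [LinearMap.mul_apply', Module.End.mul_apply, pd_pow_apply] at key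
  rw [key, map_sum]
  refine sum_congr rfl fun i _ => ?_
  rw [MvPolynomial.smul_eval, map_mul, ← eval_pd_pow_mul_shear_pow hE,
    ← eval_pd_pow_mul_shear_pow hF, Module.End.mul_apply, Module.End.mul_apply,
    pd_pow_apply, pd_pow_apply]

lemma isHomogeneous_transvectant {e f : ℕ} {E F : MvPolynomial (Fin 2) ℂ}
    (hE : E.IsHomogeneous e) (hF : F.IsHomogeneous f) (k : ℕ) :
    (transvectant e f k E F).IsHomogeneous (e - k + (f - k)) := by
  rw [transvectant, smul_eq_C_mul]
  refine IsHomogeneous.C_mul (IsHomogeneous.sum _ _ _ fun i hi => ?_) _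
  rw [smul_eq_C_mul]
  have hik : i ≤ k := Nat.lt_succ_iff.mp (mem_range.mp hi)
  refine IsHomogeneous.C_mul (IsHomogeneous.mul ?_ ?_) _
  · have := isHomogeneous_iterate_pderiv (isHomogeneous_iterate_pderiv hE 1 i) 0 (k - i)
    rwa [Nat.sub_sub, Nat.add_sub_cancel' hik] at this
  · have := isHomogeneous_iterate_pderiv (isHomogeneous_iterate_pderiv hF 1 (k - i)) 0 i
    rwa [Nat.sub_sub, Nat.sub_add_cancel hik] at this

lemma isHomogeneous_wronskian {n s : ℕ} {F : Fin s → MvPolynomial (Fin 2) ℂ}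
    (hF : ∀ i, (F i).IsHomogeneous n) : (wronskian n F).IsHomogeneous (s * (n - (s - 1))) := by
  rw [wronskian, smul_eq_C_mul, Matrix.det_apply']
  refine IsHomogeneous.C_mul (IsHomogeneous.sum _ _ _ fun σ _ => ?_) _
  have : ((σ.sign : ℤ) : MvPolynomial (Fin 2) ℂ) = C ((σ.sign : ℤ) : ℂ) := by simp
  rw [this]
  refine IsHomogeneous.C_mul ?_ _
  have hp := IsHomogeneous.prod (univ : Finset (Fin s))
    (fun i => Matrix.of (fun i j : Fin s => (⇑(pderiv (0 : Fin 2)))^[s - 1 - (j : ℕ)]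
      ((⇑(pderiv (1 : Fin 2)))^[(j : ℕ)] (F i))) (σ i) i) (fun _ => n - (s - 1)) fun i _ => by
    have := isHomogeneous_iterate_pderiv (isHomogeneous_iterate_pderiv (hF (σ i)) 1 (i : ℕ)) 0
      (s - 1 - (i : ℕ))
    rwa [Nat.sub_sub n, Nat.add_sub_cancel' (by omega)] at this
  simpa using hp

end Dehomogenization

section OrdinaryWronskian

open Polynomial in
lemma eq_zero_of_diffOp_eq_zero {b : ℕ → Polynomial ℂ} {m : ℕ} {z : ℂ} (hb : (b m).eval z ≠ 0)
    {f : Polynomial ℂ} (hf : ∑ i ∈ range (m + 1), b i * derivative^[i] f = 0)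
    (h0 : ∀ i < m, (derivative^[i] f).eval z = 0) : f = 0 := by
  by_contra hne
  set N := f.rootMultiplicity z with hN
  have hroot : ∀ {n : ℕ}, n < N ↔ ∀ i ≤ n, (derivative^[i] f).IsRoot z :=
    lt_rootMultiplicity_iff_isRoot_iterate_derivative hne
  have hmN : m ≤ N := by
    cases m with
    | zero => exact Nat.zero_le _
    | succ m => exact hroot.mpr fun i hi => h0 i (Nat.lt_succ_of_le hi)
  obtain ⟨s, hs⟩ := Nat.exists_eq_add_of_le hmN
  have hdvd : (Polynomial.X - Polynomial.C z) ^ N ∣ f := pow_rootMultiplicity_dvd f z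
  have h1 : (Polynomial.X - Polynomial.C z) ^ (s + 1) ∣ b m * derivative^[m] f := by
    rw [sum_range_succ, add_comm] at hf
    rw [eq_neg_of_add_eq_zero_left hf, dvd_neg]
    refine dvd_sum fun i hi => Dvd.dvd.mul_left ?_ _
    have hi' := mem_range.mp hi
    exact (pow_dvd_pow _ (by omega)).trans (pow_sub_dvd_iterate_derivative_of_pow_dvd i hdvd)
  have hcop : IsCoprime ((Polynomial.X - Polynomial.C z) ^ (s + 1)) (b m) := by
    refine IsCoprime.pow_left ?_
    refine (irreducible_X_sub_C z).coprime_iff_not_dvd.mpr fun h => hb ?_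
    exact dvd_iff_isRoot.mp h
  have h2 := pow_sub_dvd_iterate_derivative_of_pow_dvd s (hcop.dvd_of_dvd_mul_left h1)
  rw [Nat.add_sub_cancel_left, pow_one, ← Function.iterate_add_apply, dvd_iff_isRoot,
    add_comm, ← hs] at h2
  refine lt_irrefl N (hroot.mpr fun i hi => ?_)
  rcases hi.lt_or_eq with hi | rfl
  · exact hroot.mp hi i le_rfl
  · exact h2

lemma linearIndependent_jets {r m : ℕ} {b : ℕ → Polynomial ℂ} {z : ℂ} (hb : (b m).eval z ≠ 0)
    {a : Fin r → Polynomial ℂ} (ha : LinearIndependent ℂ a)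
    (hker : ∀ j, ∑ i ∈ range (m + 1), b i * Polynomial.derivative^[i] (a j) = 0) :
    LinearIndependent ℂ fun (i : Fin r) (j : Fin m) =>
      (Polynomial.derivative^[m - 1 - (j : ℕ)] (a i)).eval z := by
  rw [Fintype.linearIndependent_iff] at ha ⊢
  intro g hg
  have hD : ∀ k, Polynomial.derivative^[k] (∑ i, g i • a i) =
      ∑ i, g i • Polynomial.derivative^[k] (a i) := fun k => by
    rw [Polynomial.iterate_derivative_sum]
    simp
  refine ha g (eq_zero_of_diffOp_eq_zero hb ?_ fun k hk => ?_)
  · simp_rw [hD, mul_sum]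
    rw [sum_comm]
    refine sum_eq_zero fun j _ => ?_
    simp_rw [mul_smul_comm, ← smul_sum, hker, smul_zero]
  · have := congrFun hg ⟨m - 1 - k, by omega⟩
    simp only [Finset.sum_apply, Pi.smul_apply, Pi.zero_apply] at this
    rw [show m - 1 - (m - 1 - k) = k by omega] at this
    rw [hD, Polynomial.eval_finsetSum]
    simpa using this

/-- The matrix of derivatives of a family of polynomials, highest derivative first. -/
noncomputable def jetMatrix {s : ℕ} (a : Fin s → Polynomial ℂ) :
    Matrix (Fin s) (Fin s) (Polynomial ℂ) :=
  Matrix.of fun i j => Polynomial.derivative^[s - 1 - (j : ℕ)] (a i)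

lemma derivative_det {s : ℕ} (M : Matrix (Fin s) (Fin s) (Polynomial ℂ)) :
    Polynomial.derivative M.det =
      ∑ k, (M.updateCol k fun i => Polynomial.derivative (M i k)).det := by
  simp_rw [Matrix.det_apply', Polynomial.derivative_sum]
  rw [sum_comm]
  refine sum_congr rfl fun σ _ => ?_
  rw [Polynomial.derivative_intCast_mul, Polynomial.derivative_prod_finset, mul_sum]
  refine sum_congr rfl fun k _ => ?_
  rw [← mul_prod_erase univ _ (mem_univ k), mul_comm (∏ i ∈ _, _)]
  congr 2
  · simp
  · refine prod_congr rfl fun i hi => ?_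
    rw [Matrix.updateCol_ne (ne_of_mem_erase hi)]

lemma derivative_det_jetMatrix {n : ℕ} (a : Fin (n + 1) → Polynomial ℂ) :
    Polynomial.derivative (jetMatrix a).det =
      ((jetMatrix a).updateCol 0 fun i => Polynomial.derivative^[n + 1] (a i)).det := by
  rw [derivative_det, sum_eq_single 0]
  · congr 2
    ext1 i
    simp [jetMatrix, ← Function.iterate_succ_apply' (f := ⇑Polynomial.derivative)]
  · intro k _ hk
    obtain ⟨j, rfl⟩ := Fin.exists_succ_eq_of_ne_zero hk
    refine Matrix.det_zero_of_column_eq (i := j.succ) (j := j.castSucc) (by simp [Fin.ext_iff]) ?_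
    intro i
    rw [Matrix.updateCol_self, Matrix.updateCol_ne (by simp [Fin.ext_iff])]
    simp only [jetMatrix, Matrix.of_apply,
      ← Function.iterate_succ_apply' (f := ⇑Polynomial.derivative)]
    congr 2
    simp
    omega
  · simp

lemma sum_jetMatrix_mul {s : ℕ} (a : Fin (s + 1) → Polynomial ℂ) (b : ℕ → Polynomial ℂ)
    (i : Fin (s + 1)) :
    ((jetMatrix a).mulVec fun j => b (s - (j : ℕ))) i =
      ∑ k ∈ range (s + 1), b k * Polynomial.derivative^[k] (a i) := by
  rw [← sum_range_reflect, Matrix.mulVec, dotProduct, ← Fin.sum_univ_eq_sum_range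
    (fun j => b (s + 1 - 1 - j) * Polynomial.derivative^[s + 1 - 1 - j] (a i))]
  refine sum_congr rfl fun j _ => ?_
  simp [jetMatrix, mul_comm]

/-- Abel's identity. -/
lemma abel_identity {n : ℕ} {a : Fin (n + 1) → Polynomial ℂ} {b : ℕ → Polynomial ℂ}
    (hker : ∀ j, ∑ i ∈ range (n + 2), b i * Polynomial.derivative^[i] (a j) = 0) :
    b (n + 1) * Polynomial.derivative (jetMatrix a).det = -(b n * (jetMatrix a).det) := by
  have hv : (jetMatrix a).mulVec (fun j => b (n - (j : ℕ))) =
      (-b (n + 1)) • fun i => Polynomial.derivative^[n + 1] (a i) := by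
    ext1 i
    have := hker i
    rw [sum_range_succ] at this
    rw [sum_jetMatrix_mul, eq_neg_of_add_eq_zero_left this]
    simp
  have h := congrFun (Matrix.cramer_eq_adjugate_mulVec (jetMatrix a)
    ((jetMatrix a).mulVec fun j => b (n - (j : ℕ)))) 0
  rw [Matrix.mulVec_mulVec, Matrix.adjugate_mul, Matrix.smul_mulVec, Matrix.one_mulVec, hv,
    map_smul, Pi.smul_apply, Matrix.cramer_apply, ← derivative_det_jetMatrix] at h
  simp only [smul_eq_mul, Pi.smul_apply, Fin.val_zero, Nat.sub_zero] at h
  linear_combination -h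

lemma eq_C_mul_of_mul_derivative_eq {p w : Polynomial ℂ} {z : ℂ} (hp : p.eval z ≠ 0)
    (hw : w.eval z ≠ 0)
    (h : p * Polynomial.derivative w = Polynomial.derivative p * w) :
    ∃ k : ℂ, k ≠ 0 ∧ p = Polynomial.C k * w := by
  have hg : Polynomial.C (p.eval z) * w - Polynomial.C (w.eval z) * p = 0 := by
    refine eq_zero_of_diffOp_eq_zero (m := 1) (z := z)
      (b := fun i => if i = 0 then -Polynomial.derivative p else p) (by simpa using hp) ?_ ?_
    · simp only [sum_range_succ, range_zero, sum_empty, Function.iterate_zero, id,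
        Function.iterate_one, Polynomial.derivative_sub, Polynomial.derivative_C_mul]
      simp
      linear_combination Polynomial.C (p.eval z) * h
    · intro i hi
      obtain rfl : i = 0 := by omega
      simp [mul_comm]
  refine ⟨p.eval z / w.eval z, div_ne_zero hp hw, ?_⟩
  have hC : Polynomial.C (w.eval z) ≠ 0 := by simpa using hw
  refine mul_left_cancel₀ hC ?_
  rw [← mul_assoc, ← Polynomial.C_mul, mul_div_cancel₀ _ hw]
  linear_combination -hg

/-- A differential operator whose two leading coefficients satisfy `b_{n} = -b_{n+1}'` and which
annihilates `n + 1` independent polynomials is a multiple of a Wronskian operator. -/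
lemma diffOp_eq_mul_det_jetMatrix {n : ℕ} {a : Fin (n + 1) → Polynomial ℂ}
    (ha : LinearIndependent ℂ a) {b : ℕ → Polynomial ℂ} (hb : b (n + 1) ≠ 0)
    (hb' : b n = -Polynomial.derivative (b (n + 1)))
    (hker : ∀ j, ∑ i ∈ range (n + 2), b i * Polynomial.derivative^[i] (a j) = 0) :
    ∃ k : ℂ, k ≠ 0 ∧ ∀ f : Polynomial ℂ,
      ∑ i ∈ range (n + 2), b i * Polynomial.derivative^[i] f =
        Polynomial.C k * (jetMatrix (Fin.snoc a f : Fin (n + 2) → Polynomial ℂ)).det := by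
  obtain ⟨z, hz⟩ : ∃ z, (b (n + 1)).eval z ≠ 0 := by
    by_contra! h
    exact hb (Polynomial.funext fun z => by simpa using h z)
  have hw : (jetMatrix a).det.eval z ≠ 0 := by
    have hli := linearIndependent_jets hz ha hker
    have := (Matrix.linearIndependent_rows_iff_isUnit
      (A := (jetMatrix a).map (Polynomial.evalRingHom z))).mp hli
    rw [Matrix.isUnit_iff_isUnit_det, ← RingHom.mapMatrix_apply, ← RingHom.map_det] at this
    exact this.ne_zero
  obtain ⟨k, hk, hbk⟩ := eq_C_mul_of_mul_derivative_eq hz hw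
    (by rw [abel_identity hker, hb']; ring)
  have hw0 : (jetMatrix a).det ≠ 0 := fun h => hw (by simp [h])
  refine ⟨(-1) ^ (n + 1) * k, mul_ne_zero (pow_ne_zero _ (by simp)) hk, fun f => ?_⟩
  set N := jetMatrix (Fin.snoc a f : Fin (n + 2) → Polynomial ℂ) with hN
  set L := ∑ i ∈ range (n + 2), b i * Polynomial.derivative^[i] f with hL
  have hv : N.mulVec (fun j => b (n + 1 - (j : ℕ))) = Pi.single (Fin.last (n + 1)) L := by
    ext1 i
    rw [hN, sum_jetMatrix_mul]
    refine Fin.lastCases ?_ (fun i => ?_) i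
    · simp [hL]
    · rw [Fin.snoc_castSucc, hker, Pi.single_eq_of_ne (Fin.castSucc_ne_last i)]
  have h := congrArg (fun u => (N.adjugate.mulVec u) 0) hv
  simp only [Matrix.mulVec_mulVec, Matrix.adjugate_mul, Matrix.smul_mulVec, Matrix.one_mulVec,
    Matrix.mulVec_single, Pi.smul_apply, smul_eq_mul, Fin.val_zero, Nat.sub_zero] at h
  have hsub : N.submatrix (Fin.last (n + 1)).succAbove (Fin.succAbove 0) = jetMatrix a := by
    ext i j
    simp [hN, jetMatrix]
  rw [Matrix.col_apply, Matrix.adjugate_fin_succ_eq_det_submatrix, hsub, hbk] at h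
  have hs : ((-1 : Polynomial ℂ) ^ (n + 1)) * (-1) ^ (n + 1) = 1 := by
    rw [← mul_pow]; simp
  refine mul_right_cancel₀ hw0 ?_
  simp only [Fin.val_last, Fin.val_zero, add_zero, MulOpposite.smul_eq_mul_unop,
    MulOpposite.unop_op] at h
  simp only [Polynomial.C_mul, Polynomial.C_pow, Polynomial.C_neg, Polynomial.C_1]
  linear_combination (-(-1 : Polynomial ℂ) ^ (n + 1)) * h - L * (jetMatrix a).det * hs

end OrdinaryWronskian

section DehomogenizedOperators

/-- Expressing `∂₁^a ∂₂^j` through `∂₁`-derivatives at the point `(z, 1)`. -/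
lemma eval_pderiv_pderiv {n s : ℕ} {F : MvPolynomial (Fin 2) ℂ} (hF : F.IsHomogeneous n)
    (z : ℂ) (j : Fin s) :
    MvPolynomial.eval ![z, 1] ((⇑(pderiv (0 : Fin 2)))^[s - 1 - (j : ℕ)]
        ((⇑(pderiv (1 : Fin 2)))^[(j : ℕ)] F)) =
      ∑ m : Fin s, (Polynomial.derivative^[s - 1 - (m : ℕ)] (dehom F)).eval z *
        ((n - (s - 1 - (m : ℕ))).descFactorial m *
          ((-z) ^ ((j : ℕ) - m) * ((j : ℕ).choose m : ℂ))) := by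
  have hc : Commute (pd 1 + z • pd 0) ((-z) • pd 0) :=
    (commute_pd.symm.add_left ((Commute.refl _).smul_left z)).smul_right _
  have hQ : pd 1 = (pd 1 + z • pd 0) + (-z) • pd 0 := by module
  have hc' : Commute (pd 1 + z • pd 0) (pd 0) :=
    commute_pd.symm.add_left ((Commute.refl _).smul_left z)
  rw [← pd_pow_apply, ← pd_pow_apply, ← Module.End.mul_apply]
  conv_lhs => rw [hQ, hc.add_pow]
  rw [mul_sum, LinearMap.sum_apply, map_sum, Fin.sum_univ_eq_sum_range
    (fun m => (Polynomial.derivative^[s - 1 - m] (dehom F)).eval z *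
        ((n - (s - 1 - m)).descFactorial m *
          ((-z) ^ ((j : ℕ) - m) * ((j : ℕ).choose m : ℂ)))) s]
  have hsub : range ((j : ℕ) + 1) ⊆ range s := range_subset_range.mpr j.isLt
  rw [← sum_subset hsub fun m _ hm => by
    rw [Nat.choose_eq_zero_of_lt (by simpa using hm)]; simp]
  refine sum_congr rfl fun m hm => ?_
  have hmj : m ≤ j := Nat.lt_succ_iff.mp (mem_range.mp hm)
  have hop : pd 0 ^ (s - 1 - (j : ℕ)) * ((pd 1 + z • pd 0) ^ m * ((-z) • pd 0) ^ ((j : ℕ) - m) *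
      (((j : ℕ).choose m : ℕ) : Module.End ℂ (MvPolynomial (Fin 2) ℂ))) =
      ((-z) ^ ((j : ℕ) - m) * ((j : ℕ).choose m : ℂ)) •
        (pd 0 ^ (s - 1 - m) * (pd 1 + z • pd 0) ^ m) := by
    rw [smul_pow, mul_smul_comm, (hc'.pow_pow m _).eq, ← nsmul_eq_mul', mul_smul_comm,
      mul_smul_comm, ← mul_assoc, ← pow_add, mul_comm ((-z) ^ _), mul_smul,
      ← Nat.cast_smul_eq_nsmul ℂ]
    congr 4
    omega
  rw [hop, LinearMap.smul_apply, MvPolynomial.smul_eval, eval_pd_pow_mul_shear_pow hF]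
  ring

lemma exists_dehom_wronskian {n s : ℕ} (hs : s ≤ n + 1) :
    ∃ c : ℂ, c ≠ 0 ∧ ∀ F : Fin s → MvPolynomial (Fin 2) ℂ, (∀ i, (F i).IsHomogeneous n) →
      dehom (wronskian n F) = Polynomial.C c * (jetMatrix fun i => dehom (F i)).det := by
  refine ⟨(((n - s + 1).factorial : ℂ) / (n.factorial : ℂ)) ^ s *
    ∏ m : Fin s, ((n - (s - 1 - (m : ℕ))).descFactorial m : ℂ), ?_, fun F hF => ?_⟩
  · refine mul_ne_zero (pow_ne_zero _ (div_ne_zero ?_ ?_)) (prod_ne_zero_iff.mpr fun m _ => ?_)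
    · exact_mod_cast Nat.factorial_ne_zero _
    · exact_mod_cast Nat.factorial_ne_zero _
    · rw [Nat.cast_ne_zero, ← Nat.pos_iff_ne_zero, Nat.pos_iff_ne_zero, Ne,
        Nat.descFactorial_eq_zero_iff_lt]
      have := m.isLt
      omega
  · refine Polynomial.funext fun z => ?_
    let V : Matrix (Fin s) (Fin s) ℂ := Matrix.of fun m j =>
      ((n - (s - 1 - (m : ℕ))).descFactorial m *
          ((-z) ^ ((j : ℕ) - m) * ((j : ℕ).choose m : ℂ)))
    have hV : V.det = ∏ m : Fin s, ((n - (s - 1 - (m : ℕ))).descFactorial m : ℂ) := by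
      rw [Matrix.det_of_isUpperTriangular]
      · simp [V]
      · intro m j hjm
        have hlt : (j : ℕ) < m := hjm
        simp [V, Nat.choose_eq_zero_of_lt hlt]
    have hmat : ((Matrix.of fun i j : Fin s => (⇑(pderiv (0 : Fin 2)))^[s - 1 - (j : ℕ)]
        ((⇑(pderiv (1 : Fin 2)))^[(j : ℕ)] (F i))).map (MvPolynomial.eval ![z, 1])) =
        ((jetMatrix fun i => dehom (F i)).map (Polynomial.evalRingHom z)) * V := by
      ext i j
      rw [Matrix.mul_apply, Matrix.map_apply, Matrix.of_apply, eval_pderiv_pderiv (hF i)]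
      simp [jetMatrix, V]
    rw [eval_dehom, wronskian, MvPolynomial.smul_eval, RingHom.map_det, RingHom.mapMatrix_apply,
      hmat, Matrix.det_mul, hV, ← RingHom.mapMatrix_apply, ← RingHom.map_det]
    simp only [Polynomial.coe_evalRingHom, Polynomial.eval_mul, Polynomial.eval_C]
    ring

/-- The coefficient of `f^{(i)}` in the dehomogenized transvectant `(E, F)_k`. -/
noncomputable def transvectantCoeff (e f k : ℕ) (ε : Polynomial ℂ) (i : ℕ) : Polynomial ℂ :=
  Polynomial.C ((((e - k).factorial * (f - k).factorial : ℕ) : ℂ) /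
      ((e.factorial * f.factorial : ℕ) : ℂ) * ((-1 : ℂ) ^ i * (k.choose i : ℂ) *
        ((e - (k - i)).descFactorial i * (f - i).descFactorial (k - i)))) *
    Polynomial.derivative^[k - i] ε

lemma transvectantCoeff_of_lt {e f k : ℕ} {ε : Polynomial ℂ} {i : ℕ} (h : k < i) :
    transvectantCoeff e f k ε i = 0 := by
  simp [transvectantCoeff, Nat.choose_eq_zero_of_lt h]

lemma transvectantCoeff_zero {e f k : ℕ} {i : ℕ} :
    transvectantCoeff e f k 0 i = 0 := by
  simp [transvectantCoeff]

lemma transvectantCoeff_self_ne_zero {e f k : ℕ} {ε : Polynomial ℂ} (hk : k ≤ e) (hε : ε ≠ 0) :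
    transvectantCoeff e f k ε k ≠ 0 := by
  simp [transvectantCoeff, hε, Nat.factorial_ne_zero, hk]

/-- The two leading coefficients of the transvectant operator of order `k`. -/
lemma transvectantCoeff_pred {f k : ℕ} (hk : k + 1 ≤ f) (ε : Polynomial ℂ) :
    transvectantCoeff ((k + 1) * (f - k)) f (k + 1) ε k =
      -Polynomial.derivative (transvectantCoeff ((k + 1) * (f - k)) f (k + 1) ε (k + 1)) := by
  obtain ⟨e, he⟩ : ∃ e, (k + 1) * (f - k) = e + 1 :=
    Nat.exists_eq_succ_of_ne_zero (by
      have : f - k ≠ 0 := by omega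
      positivity)
  have hfac : (((e + 1).descFactorial (k + 1) : ℕ) : ℂ) =
      ((k + 1 : ℕ) : ℂ) * ((f - k : ℕ) : ℂ) * (e.descFactorial k : ℂ) := by
    rw [Nat.succ_descFactorial_succ, ← he]
    push_cast
    ring
  rw [transvectantCoeff, transvectantCoeff, he, Polynomial.derivative_C_mul,
    ← neg_mul, ← Polynomial.C_neg]
  have h1 : k + 1 - k = 1 := by omega
  simp only [Nat.sub_self, Function.iterate_zero, id, Nat.sub_zero, h1, Function.iterate_one,
    Nat.choose_self, Nat.choose_succ_self_right, Nat.add_sub_cancel, Nat.descFactorial_one,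
    Nat.descFactorial_zero, hfac]
  congr 2
  push_cast
  ring

lemma dehom_transvectant {e f k r : ℕ} (hkr : k ≤ r) {E F : MvPolynomial (Fin 2) ℂ}
    (hE : E.IsHomogeneous e) (hF : F.IsHomogeneous f) :
    dehom (transvectant e f k E F) =
      ∑ i ∈ range (r + 1), transvectantCoeff e f k (dehom E) i *
        Polynomial.derivative^[i] (dehom F) := by
  rw [← sum_subset (range_subset_range.mpr (Nat.succ_le_succ hkr)) fun i _ hi => by
    rw [transvectantCoeff_of_lt (by simpa using hi), zero_mul]]
  refine Polynomial.funext fun z => ?_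
  rw [eval_dehom_transvectant hE hF, Polynomial.eval_finsetSum, mul_sum]
  refine sum_congr rfl fun i _ => ?_
  simp [transvectantCoeff]
  ring

/-- The coefficients of the dehomogenized operator `F ↦ ∑ (E_q, F)_{r-q}`. -/
noncomputable def combinedCoeff (d r : ℕ) (E : ℕ → MvPolynomial (Fin 2) ℂ) (i : ℕ) :
    Polynomial ℂ :=
  ∑ q ∈ Nset r, transvectantCoeff (r * (d - r + 1) - 2 * q) d (r - q) (dehom (E q)) i

variable {d r : ℕ} {E : ℕ → MvPolynomial (Fin 2) ℂ}

lemma dehom_sum_transvectant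
    (hE : ∀ q ∈ Nset r, (E q).IsHomogeneous (r * (d - r + 1) - 2 * q))
    {F : MvPolynomial (Fin 2) ℂ} (hF : F.IsHomogeneous d) :
    dehom (∑ q ∈ Nset r, transvectant (r * (d - r + 1) - 2 * q) d (r - q) (E q) F) =
      ∑ i ∈ range (r + 1), combinedCoeff d r E i * Polynomial.derivative^[i] (dehom F) := by
  rw [map_sum, sum_congr rfl fun q hq =>
    dehom_transvectant (Nat.sub_le r q) (hE q hq) hF, sum_comm]
  simp_rw [combinedCoeff, sum_mul]

lemma isHomogeneous_sum_transvectant (hrd : r + 1 ≤ d)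
    (hE : ∀ q ∈ Nset r, (E q).IsHomogeneous (r * (d - r + 1) - 2 * q))
    {F : MvPolynomial (Fin 2) ℂ} (hF : F.IsHomogeneous d) :
    (∑ q ∈ Nset r, transvectant (r * (d - r + 1) - 2 * q) d (r - q) (E q) F).IsHomogeneous
      ((r + 1) * (d - r)) := by
  refine IsHomogeneous.sum _ _ _ fun q hq => ?_
  have h := isHomogeneous_transvectant (hE q hq) hF (r - q)
  have hqr : q ≤ r := by simp [Nset] at hq; omega
  convert h using 1
  obtain ⟨m, rfl⟩ := Nat.exists_eq_add_of_le hrd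
  obtain ⟨p, rfl⟩ := Nat.exists_eq_add_of_le hqr
  have h1 : q + p + 1 + m - (q + p) = m + 1 := by omega
  rw [h1]
  zify [show q + p - q ≤ q + p + 1 + m by omega, show q ≤ q + p by omega,
    show 2 * q ≤ (q + p) * (m + 1 + 1) by nlinarith,
    show q + p - q ≤ (q + p) * (m + 1 + 1) - 2 * q by
      rw [Nat.add_sub_cancel_left]
      apply Nat.le_sub_of_add_le
      nlinarith]
  ring

/-- If `r` independent polynomials are annihilated, then `E₀ ≠ 0`. -/
lemma head_ne_zero (hrd : r + 1 ≤ d)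
    (hE : ∀ q ∈ Nset r, (E q).IsHomogeneous (r * (d - r + 1) - 2 * q))
    (hne : ∃ q ∈ Nset r, E q ≠ 0) {a : Fin r → Polynomial ℂ} (ha : LinearIndependent ℂ a)
    (hker : ∀ j, ∑ i ∈ range (r + 1), combinedCoeff d r E i *
      Polynomial.derivative^[i] (a j) = 0) : E 0 ≠ 0 := by
  classical
  obtain ⟨hmem, hq0⟩ := Nat.find_spec hne
  have hmin : ∀ q < Nat.find hne, q ∈ Nset r → E q = 0 := fun q hq hqm => by
    by_contra h
    exact Nat.find_min hne hq ⟨hqm, h⟩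
  generalize Nat.find hne = q₀ at hmem hq0 hmin
  have hq₀r : q₀ ≤ r := by simp [Nset] at hmem; omega
  have hcoeff : ∀ i, r - q₀ ≤ i → combinedCoeff d r E i =
      transvectantCoeff (r * (d - r + 1) - 2 * q₀) d (r - q₀) (dehom (E q₀)) i := by
    intro i hi
    refine sum_eq_single_of_mem q₀ hmem fun q hq hne' => ?_
    rcases lt_or_gt_of_ne hne' with h | h
    · rw [hmin q h hq, map_zero, transvectantCoeff_zero]
    · have hqr : q ≤ r := by simp [Nset] at hq; omega
      exact transvectantCoeff_of_lt (by omega)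
  have hle : r - q₀ ≤ r * (d - r + 1) - 2 * q₀ := by
    obtain ⟨m, rfl⟩ := Nat.exists_eq_add_of_le hrd
    apply Nat.le_sub_of_add_le
    have : r + 1 + m - r + 1 = m + 2 := by omega
    rw [this]
    nlinarith [Nat.sub_add_cancel hq₀r]
  have hlead : combinedCoeff d r E (r - q₀) ≠ 0 := by
    rw [hcoeff _ le_rfl]
    exact transvectantCoeff_self_ne_zero hle fun h => hq0 (eq_zero_of_dehom_eq_zero (hE _ hmem) h)
  obtain ⟨z, hz⟩ : ∃ z, (combinedCoeff d r E (r - q₀)).eval z ≠ 0 := by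
    by_contra! h
    exact hlead (Polynomial.funext fun z => by simpa using h z)
  have hli := linearIndependent_jets hz ha fun j => by
    rw [← hker j]
    refine sum_subset (range_subset_range.mpr (by omega)) fun i _ hi => ?_
    have hlt : r - q₀ < i := by simpa using hi
    rw [hcoeff i hlt.le, transvectantCoeff_of_lt hlt, zero_mul]
  have hcard := hli.fintype_card_le_finrank
  rw [Module.finrank_fintype_fun_eq_card, Fintype.card_fin, Fintype.card_fin] at hcard
  rwa [show q₀ = 0 by omega] at hq0

lemma linearIndependent_dehom {ι : Type*} [Fintype ι] {A : ι → MvPolynomial (Fin 2) ℂ}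
    (hA : LinearIndependent ℂ A) (hd : ∀ i, (A i).IsHomogeneous d) :
    LinearIndependent ℂ fun i => dehom (A i) := by
  rw [Fintype.linearIndependent_iff] at hA ⊢
  refine fun g hg => hA g (eq_zero_of_dehom_eq_zero (n := d) ?_ (by simpa using hg))
  refine IsHomogeneous.sum _ _ _ fun i _ => ?_
  rw [smul_eq_C_mul]
  exact (hd i).C_mul _

/-- A combination of transvectants annihilating `r` independent forms is a Wronskian operator. -/
lemma exists_eq_smul_wronskian (hr : 1 ≤ r) (hrd : r + 1 ≤ d)
    (hE : ∀ q ∈ Nset r, (E q).IsHomogeneous (r * (d - r + 1) - 2 * q))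
    (hne : ∃ q ∈ Nset r, E q ≠ 0) {A : Fin r → MvPolynomial (Fin 2) ℂ}
    (hA : LinearIndependent ℂ A) (hAd : ∀ i, (A i).IsHomogeneous d)
    (hker : ∀ i, ∑ q ∈ Nset r,
      transvectant (r * (d - r + 1) - 2 * q) d (r - q) (E q) (A i) = 0) :
    ∃ k : ℂ, k ≠ 0 ∧ ∀ F : MvPolynomial (Fin 2) ℂ, F.IsHomogeneous d →
      ∑ q ∈ Nset r, transvectant (r * (d - r + 1) - 2 * q) d (r - q) (E q) F =
        k • wronskian d (Fin.snoc A F : Fin (r + 1) → MvPolynomial (Fin 2) ℂ) := by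
  have hker' : ∀ j, ∑ i ∈ range (r + 1), combinedCoeff d r E i *
      Polynomial.derivative^[i] (dehom (A j)) = 0 := fun j => by
    rw [← dehom_sum_transvectant hE (hAd j), hker j, map_zero]
  have ha := linearIndependent_dehom hA hAd
  have hE0 := head_ne_zero hrd hE hne ha hker'
  obtain ⟨n, rfl⟩ : ∃ n, r = n + 1 := ⟨r - 1, by omega⟩
  have hmem : 0 ∈ Nset (n + 1) := by simp [Nset]
  have hcoeff : ∀ i, n ≤ i → combinedCoeff d (n + 1) E i =
      transvectantCoeff ((n + 1) * (d - n)) d (n + 1) (dehom (E 0)) i := by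
    intro i hi
    rw [combinedCoeff, sum_eq_single_of_mem 0 hmem fun q hq hne' => ?_]
    · rw [show d - (n + 1) + 1 = d - n by omega]
      simp
    · have hq' : q < n + 1 + 1 ∧ q ≠ 1 := by simpa [Nset] using hq
      exact transvectantCoeff_of_lt (by omega)
  have hdε : dehom (E 0) ≠ 0 := fun h => hE0 (eq_zero_of_dehom_eq_zero (hE 0 hmem) h)
  obtain ⟨k, hk, hop⟩ := diffOp_eq_mul_det_jetMatrix ha (b := combinedCoeff d (n + 1) E)
    (by
      rw [hcoeff _ (Nat.le_succ n)]
      refine transvectantCoeff_self_ne_zero ?_ hdε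
      exact Nat.le_mul_of_pos_right _ (by omega))
    (by rw [hcoeff _ le_rfl, hcoeff _ (Nat.le_succ n), transvectantCoeff_pred (by omega)]) hker'
  obtain ⟨c, hc, hw⟩ := exists_dehom_wronskian (n := d) (s := n + 1 + 1) (by omega)
  refine ⟨k / c, div_ne_zero hk hc, fun F hF => ?_⟩
  have hsnoc : ∀ i, ((Fin.snoc A F : Fin (n + 1 + 1) → MvPolynomial (Fin 2) ℂ) i).IsHomogeneous
      d := Fin.lastCases (by simpa using hF) fun i => by simpa using hAd i
  refine sub_eq_zero.mp (eq_zero_of_dehom_eq_zero (n := (n + 1 + 1) * (d - (n + 1))) ?_ ?_)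
  · refine IsHomogeneous.sub (isHomogeneous_sum_transvectant hrd hE hF) ?_
    rw [smul_eq_C_mul]
    exact (isHomogeneous_wronskian hsnoc).C_mul _
  · have hcomp : (fun i => dehom ((Fin.snoc A F : Fin (n + 1 + 1) → MvPolynomial (Fin 2) ℂ) i)) =
        Fin.snoc (fun i => dehom (A i)) (dehom F) := by
      ext1 i
      refine Fin.lastCases ?_ (fun i => ?_) i <;> simp
    rw [map_sub, map_smul, hw _ hsnoc, dehom_sum_transvectant hE hF, hop, hcomp,
      Polynomial.smul_eq_C_mul, ← mul_assoc, ← Polynomial.C_mul, div_mul_cancel₀ _ hc, sub_self]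

lemma wronskian_snoc_self (A : Fin r → MvPolynomial (Fin 2) ℂ) (i : Fin r) :
    wronskian d (Fin.snoc A (A i) : Fin (r + 1) → MvPolynomial (Fin 2) ℂ) = 0 := by
  rw [wronskian, Matrix.det_zero_of_row_eq (Fin.castSucc_ne_last i) (by ext1 j; simp), smul_zero]

end DehomogenizedOperators

lemma exists_linearIndependent_fin_of_le_rank_span {K V : Type*} [DivisionRing K]
    [AddCommGroup V] [Module K V] {S : Set V} {r : ℕ}
    (h : (r : Cardinal) ≤ Module.rank K (Submodule.span K S)) :
    ∃ A : Fin r → V, LinearIndependent K A ∧ ∀ i, A i ∈ S := by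
  obtain ⟨B, hBS, hspan, hBli⟩ := exists_linearIndependent K S
  rw [← hspan, rank_span_set hBli] at h
  obtain ⟨T, hTB, hT⟩ := Cardinal.le_mk_iff_exists_subset.mp h
  have hfin : Finite T := by
    rw [← Cardinal.lt_aleph0_iff_finite, hT]
    exact Cardinal.natCast_lt_aleph0
  have hcard : Nat.card T = r := by rw [Nat.card, hT, Cardinal.toNat_natCast]
  let φ : Fin r ≃ T := (Finite.equivFinOfCardEq hcard).symm
  exact ⟨fun i => φ i, hBli.comp (fun i => ⟨φ i, hTB (φ i).2⟩) fun i j hij =>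
    φ.injective (Subtype.ext (congrArg (fun x : B => (x : V)) hij)), fun i => hBS (hTB (φ i).2)⟩

/-- for `2 ≤ r ≤ d-1` and a family `(E_q)` of binary forms of order
`r(d-r+1)-2q`, not all zero, the vector space of binary forms `F` of order `d` with
`Σ_q (E_q, F)_(r-q) = 0` has dimension at least `r` iff there exist linearly
independent forms `A₁,...,A_r` of order `d` and a nonzero constant `k` with
`Σ_q (E_q, F)_(r-q) = k • W(A₁,...,A_r,F)` for every form `F` of order `d`. -/
theorem dim_ge_iff_wronskian (d r : ℕ) (hr2 : 2 ≤ r) (hrd : r ≤ d - 1)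
    (E : ℕ → MvPolynomial (Fin 2) ℂ)
    (hE : ∀ q ∈ Nset r, (E q).IsHomogeneous (r * (d - r + 1) - 2 * q))
    (hne : ∃ q ∈ Nset r, E q ≠ 0) :
    ((r : Cardinal) ≤ Module.rank ℂ
        (Submodule.span ℂ {F : MvPolynomial (Fin 2) ℂ | F.IsHomogeneous d ∧
          ∑ q ∈ Nset r, transvectant (r * (d - r + 1) - 2 * q) d (r - q) (E q) F = 0})) ↔
      ∃ (A : Fin r → MvPolynomial (Fin 2) ℂ) (k : ℂ), LinearIndependent ℂ A ∧
        (∀ i, (A i).IsHomogeneous d) ∧ k ≠ 0 ∧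
        ∀ F : MvPolynomial (Fin 2) ℂ, F.IsHomogeneous d →
          ∑ q ∈ Nset r, transvectant (r * (d - r + 1) - 2 * q) d (r - q) (E q) F =
            k • wronskian d (Fin.snoc A F) := by
  have hrd' : r + 1 ≤ d := by omega
  constructor
  · intro h
    obtain ⟨A, hA, hmem⟩ := exists_linearIndependent_fin_of_le_rank_span h
    obtain ⟨k, hk, hop⟩ := exists_eq_smul_wronskian (by omega) hrd' hE hne hA
      (fun i => (hmem i).1) fun i => (hmem i).2
    exact ⟨A, k, hA, fun i => (hmem i).1, hk, hop⟩
  · rintro ⟨A, k, hA, hAd, -, hop⟩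
    have hmem : ∀ i, A i ∈ Submodule.span ℂ {F : MvPolynomial (Fin 2) ℂ | F.IsHomogeneous d ∧
        ∑ q ∈ Nset r, transvectant (r * (d - r + 1) - 2 * q) d (r - q) (E q) F = 0} := fun i =>
      Submodule.subset_span ⟨hAd i, by rw [hop _ (hAd i), wronskian_snoc_self, smul_zero]⟩
    have hli : LinearIndependent ℂ fun i => (⟨A i, hmem i⟩ : Submodule.span ℂ _) :=
      LinearIndependent.of_comp (Submodule.subtype _) hA
    simpa using hli.cardinal_lift_le_rank
end

section
/- Let d ≥ 3 be an integer and let A₁, A₂, F be binary forms of order d over ℂ. Then W(A₁, A₂, F) = ((A₁,A₂)_1, F)_2 + ((2−d)/(4d−6)) · (A₁,A₂)_3 · F. In other words, the pair C₀ = (A₁,A₂)_1, C₂ = ((2−d)/(4d−6))·(A₁,A₂)_3 is the Wronskian-combinant collection of the pair (A₁, A₂). -/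
open MvPolynomial Finset

theorem pderiv_one_pderiv_zero (p : MvPolynomial (Fin 2) ℂ) :
    pderiv 1 (pderiv 0 p) = pderiv 0 (pderiv 1 p) := by
  have h : ⁅pderiv (R := ℂ) (1 : Fin 2), pderiv (R := ℂ) (0 : Fin 2)⁆ = 0 := by
    ext i
    fin_cases i <;> simp [Derivation.commutator_apply, pderiv_X]
  have h' := Derivation.congr_fun h p
  simpa [Derivation.commutator_apply, sub_eq_zero] using h'

/-- Euler's identity for a binary form of positive order, solved for the value of the form. -/
theorem eval_eq_of_isHomogeneous_succ {m : ℕ} {p : MvPolynomial (Fin 2) ℂ}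
    (hp : p.IsHomogeneous (m + 1)) (v : Fin 2 → ℂ) :
    eval v p =
      (v 0 * eval v (pderiv 0 p) + v 1 * eval v (pderiv 1 p)) / ((m : ℂ) + 1) := by
  have h := congrArg (eval v) hp.sum_X_mul_pderiv
  have hm : (m : ℂ) + 1 ≠ 0 := by exact_mod_cast m.succ_ne_zero
  rw [eq_div_iff hm]
  simp [Fin.sum_univ_two] at h
  rw [h]
  ring

/-- The derivatives of order at most two of a binary form, in terms of its third derivatives. -/
theorem eval_pderiv_of_isHomogeneous {n : ℕ} {p : MvPolynomial (Fin 2) ℂ}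
    (hp : p.IsHomogeneous (n + 3)) (v : Fin 2 → ℂ) :
    ∃ a b c d : ℂ,
      eval v (pderiv 0 (pderiv 0 (pderiv 0 p))) = a ∧
      eval v (pderiv 0 (pderiv 0 (pderiv 1 p))) = b ∧
      eval v (pderiv 0 (pderiv 1 (pderiv 1 p))) = c ∧
      eval v (pderiv 1 (pderiv 1 (pderiv 1 p))) = d ∧
      eval v (pderiv 0 (pderiv 0 p)) = (v 0 * a + v 1 * b) / ((n : ℂ) + 1) ∧
      eval v (pderiv 0 (pderiv 1 p)) = (v 0 * b + v 1 * c) / ((n : ℂ) + 1) ∧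
      eval v (pderiv 1 (pderiv 1 p)) = (v 0 * c + v 1 * d) / ((n : ℂ) + 1) ∧
      eval v (pderiv 0 p) = (v 0 ^ 2 * a + 2 * v 0 * v 1 * b + v 1 ^ 2 * c) /
        (((n : ℂ) + 1) * (n + 2)) ∧
      eval v (pderiv 1 p) = (v 0 ^ 2 * b + 2 * v 0 * v 1 * c + v 1 ^ 2 * d) /
        (((n : ℂ) + 1) * (n + 2)) ∧
      eval v p = (v 0 ^ 3 * a + 3 * v 0 ^ 2 * v 1 * b + 3 * v 0 * v 1 ^ 2 * c + v 1 ^ 3 * d) /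
        (((n : ℂ) + 1) * (n + 2) * (n + 3)) := by
  have h₁ (i : Fin 2) : (pderiv i p).IsHomogeneous (n + 2) := hp.pderiv
  have h₂ (i j : Fin 2) : (pderiv i (pderiv j p)).IsHomogeneous (n + 1) := (h₁ j).pderiv
  have e₁ : (n : ℂ) + 1 ≠ 0 := by exact_mod_cast n.succ_ne_zero
  have e₂ : (n : ℂ) + 2 ≠ 0 := by exact_mod_cast (n + 1).succ_ne_zero
  have e₃ : (n : ℂ) + 3 ≠ 0 := by exact_mod_cast (n + 2).succ_ne_zero
  have c₂ : (n : ℂ) + 1 + 1 = n + 2 := by ring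
  have c₃ : (n : ℂ) + 2 + 1 = n + 3 := by ring
  have d₀₀ := eval_eq_of_isHomogeneous_succ (h₂ 0 0) v
  have d₀₁ := eval_eq_of_isHomogeneous_succ (h₂ 0 1) v
  have d₁₁ := eval_eq_of_isHomogeneous_succ (h₂ 1 1) v
  have d₀ := eval_eq_of_isHomogeneous_succ (h₁ 0) v
  have d₁ := eval_eq_of_isHomogeneous_succ (h₁ 1) v
  have d := eval_eq_of_isHomogeneous_succ hp v
  push_cast at d d₀ d₁
  simp only [pderiv_one_pderiv_zero, c₂, c₃] at d d₀ d₁ d₀₀ d₀₁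
  refine ⟨_, _, _, _, rfl, rfl, rfl, rfl, d₀₀, d₀₁, d₁₁, ?_, ?_, ?_⟩
  · rw [d₀, d₀₀, d₀₁]
    field_simp
    ring
  · rw [d₁, d₀₁, d₁₁]
    field_simp
    ring
  · rw [d, d₀, d₁, d₀₀, d₀₁, d₁₁]
    field_simp
    ring

/-- for an integer `d ≥ 3` and binary forms `A₁, A₂, F` of order `d`,
`W(A₁, A₂, F) = ((A₁,A₂)_1, F)_2 + ((2-d)/(4d-6)) • ((A₁,A₂)_3 * F)`;
i.e. `C₀ = (A₁,A₂)_1`, `C₂ = ((2-d)/(4d-6)) • (A₁,A₂)_3` is the Wronskian-combinant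
collection of the pair `(A₁, A₂)`. -/
theorem wronskian_pair_eq (d : ℕ) (hd : 3 ≤ d)
    (A₁ A₂ F : MvPolynomial (Fin 2) ℂ)
    (hA₁ : A₁.IsHomogeneous d) (hA₂ : A₂.IsHomogeneous d) (hF : F.IsHomogeneous d) :
    wronskian d ![A₁, A₂, F] =
      transvectant (2 * d - 2) d 2 (transvectant d d 1 A₁ A₂) F +
        (((2 : ℂ) - (d : ℂ)) / (4 * (d : ℂ) - 6)) •
          (transvectant d d 3 A₁ A₂ * F) := by
  obtain ⟨n, rfl⟩ : ∃ n, d = n + 3 := ⟨d - 3, by omega⟩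
  have e₁ : (n : ℂ) + 1 ≠ 0 := by exact_mod_cast n.succ_ne_zero
  have e₂ : (n : ℂ) + 2 ≠ 0 := by exact_mod_cast (n + 1).succ_ne_zero
  have e₃ : (n : ℂ) + 3 ≠ 0 := by exact_mod_cast (n + 2).succ_ne_zero
  have e₄ : (n : ℂ) * 2 + 3 ≠ 0 := by exact_mod_cast (n * 2 + 2).succ_ne_zero
  have hn : (n.factorial : ℂ) ≠ 0 := by exact_mod_cast n.factorial_ne_zero
  have hn₂ : ((2 * n + 2).factorial : ℂ) ≠ 0 := by exact_mod_cast (2 * n + 2).factorial_ne_zero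
  have c₂ : (n : ℂ) + 1 + 1 = n + 2 := by ring
  have c₃ : (n : ℂ) + 2 + 1 = n + 3 := by ring
  have c₄ : 2 * (n : ℂ) + 2 + 1 = 2 * n + 3 := by ring
  have c₅ : 2 * (n : ℂ) + 3 + 1 = 2 * n + 4 := by ring
  have w : ((n + 3 - 3 + 1).factorial : ℂ) / ((n + 3).factorial : ℂ) =
      1 / ((n + 2) * (n + 3)) := by
    rw [show n + 3 - 3 + 1 = n + 1 by omega]
    simp only [Nat.factorial_succ]
    push_cast
    simp only [c₂, c₃]
    field_simp
  have t₁ : (((n + 3 - 1).factorial * (n + 3 - 1).factorial : ℕ) : ℂ) /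
      (((n + 3).factorial * (n + 3).factorial : ℕ) : ℂ) = 1 / (n + 3) ^ 2 := by
    rw [show n + 3 - 1 = n + 2 by omega]
    simp only [Nat.factorial_succ]
    push_cast
    simp only [c₂, c₃]
    field_simp
  have t₂ : (((2 * (n + 3) - 2 - 2).factorial * (n + 3 - 2).factorial : ℕ) : ℂ) /
      (((2 * (n + 3) - 2).factorial * (n + 3).factorial : ℕ) : ℂ) =
      1 / ((2 * n + 3) * (2 * n + 4) * (n + 2) * (n + 3)) := by
    rw [show 2 * (n + 3) - 2 - 2 = 2 * n + 2 by omega, show n + 3 - 2 = n + 1 by omega,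
      show 2 * (n + 3) - 2 = 2 * n + 2 + 1 + 1 by omega]
    rw [Nat.factorial_succ (2 * n + 2 + 1), Nat.factorial_succ (2 * n + 2),
      Nat.factorial_succ (n + 2), Nat.factorial_succ (n + 1), Nat.factorial_succ n]
    push_cast
    simp only [c₂, c₃, c₄, c₅]
    field_simp
  have t₃ : (((n + 3 - 3).factorial * (n + 3 - 3).factorial : ℕ) : ℂ) /
      (((n + 3).factorial * (n + 3).factorial : ℕ) : ℂ) =
      1 / ((n + 1) * (n + 2) * (n + 3)) ^ 2 := by
    rw [show n + 3 - 3 = n by omega]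
    simp only [Nat.factorial_succ]
    push_cast
    simp only [c₂, c₃]
    field_simp
  apply MvPolynomial.funext
  intro v
  obtain ⟨a0, a1, a2, a3, ha0, ha1, ha2, ha3, ha4, ha5, ha6, ha7, ha8, -⟩ :=
    eval_pderiv_of_isHomogeneous hA₁ v
  obtain ⟨b0, b1, b2, b3, hb0, hb1, hb2, hb3, hb4, hb5, hb6, hb7, hb8, -⟩ :=
    eval_pderiv_of_isHomogeneous hA₂ v
  obtain ⟨f0, f1, f2, f3, -, -, -, -, hf4, hf5, hf6, -, -, hf9⟩ :=
    eval_pderiv_of_isHomogeneous hF v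
  simp only [wronskian, transvectant, w, t₁, t₂, t₃]
  simp only [Matrix.det_fin_three, Finset.sum_range_succ, Finset.sum_range_zero, zero_add,
    Matrix.of_apply, Fin.val_zero, Fin.val_one, Fin.val_two, Nat.reduceSub, Nat.reduceAdd,
    Function.iterate_succ, Function.iterate_zero, tsub_self, Function.iterate_zero_apply, Function.comp_apply, id_eq,
    Matrix.cons_val_zero, Matrix.cons_val_one, Matrix.cons_val, map_add, map_sub,
    Derivation.leibniz, Derivation.map_smul, smul_eq_mul, pderiv_one_pderiv_zero,
    smul_eval, map_mul]
  simp only [ha0, ha1, ha2, ha3, ha4, ha5, ha6, ha7, ha8, hb0, hb1, hb2, hb3, hb4, hb5, hb6,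
    hb7, hb8, hf4, hf5, hf6, hf9]
  have e₆ : 4 * ((n + 3 : ℕ) : ℂ) - 6 = 2 * (2 * n + 3) := by push_cast; ring
  have e₇ : 2 * (n : ℂ) + 4 = 2 * (n + 2) := by ring
  have k₃₂ : Nat.choose 3 2 = 3 := rfl
  rw [e₆, e₇]
  simp only [Nat.choose_zero_right, Nat.choose_self, Nat.choose_one_right, k₃₂]
  push_cast
  field_simp
  ring
end

section
/- Let r ≥ 1 be an integer, let a₁,…,a_r ∈ ℂ and u ∈ ℂ with u ≠ a_i for every i. Let M be the r×r matrix whose i-th row is (1/(a_i−u)², a_i^{r−2}, a_i^{r−3}, …, a_i, 1), i.e., M_{i,1} = 1/(a_i−u)² and M_{i,j} = a_i^{r−j} for 2 ≤ j ≤ r. Then det M = (−1)^{r−1} · ((∏_{1≤j<k≤r} (a_j − a_k)) / (∏_{i=1}^{r} (a_i − u))) · Σ_{i=1}^{r} 1/(a_i − u). -/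
open Finset

open Polynomial in
/-- The determinant of the matrix obtained from the Vandermonde matrix with decreasing powers by
replacing its first column with the values of a polynomial of degree less than `n + 1`. -/
theorem det_eval_vandermonde_column {R : Type*} [CommRing R] {n : ℕ} (a : Fin (n + 1) → R)
    (p : R[X]) (hp : p.natDegree < n + 1) :
    Matrix.det (Matrix.of fun i j : Fin (n + 1) =>
        if (j : ℕ) = 0 then p.eval (a i) else a i ^ (n - (j : ℕ))) =
      p.coeff n * ∏ j : Fin (n + 1), ∏ k ∈ Finset.Ioi j, (a j - a k) := by
  have hV : (Matrix.projVandermonde 1 a).det =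
      ∏ j : Fin (n + 1), ∏ k ∈ Finset.Ioi j, (a j - a k) := by
    simp [Matrix.det_projVandermonde]
  have h := Matrix.det_updateCol_sum (Matrix.projVandermonde 1 a) 0
    (fun j => p.coeff (n - (j : ℕ)))
  rw [hV] at h
  simp only [Fin.val_zero, Nat.sub_zero, smul_eq_mul] at h
  rw [← h]
  congr 1
  ext i j
  by_cases hj : j = 0
  · subst hj
    simp only [Matrix.of_apply, Fin.val_zero, if_true, Matrix.updateCol_self]
    rw [eval_eq_sum_range' hp, ← Fin.sum_univ_eq_sum_range (fun k => p.coeff k * a i ^ k),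
      ← Equiv.sum_comp Fin.revPerm]
    refine Finset.sum_congr rfl fun k _ => ?_
    simp [Matrix.projVandermonde_apply, Fin.val_rev]
  · simp [hj, Matrix.projVandermonde_apply, Fin.val_rev]

open Polynomial in
/-- A polynomial `P` of degree `n + 1` with `P u ≠ 0` gives rise to a polynomial of degree at most
`n` that takes the value `((x - u) ^ 2)⁻¹` at every root `x` of `P`. -/
theorem exists_eval_eq_inv_sq_of_isRoot {K : Type*} [Field K] {n : ℕ} {P : K[X]} (hP : P.Monic)
    (hdeg : P.natDegree = n + 1) {u : K} (hu : P.eval u ≠ 0) :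
    ∃ p : K[X], p.natDegree < n + 1 ∧
      p.coeff n = P.derivative.eval u / P.eval u ^ 2 ∧
      ∀ x, P.IsRoot x → p.eval x = ((x - u) ^ 2)⁻¹ := by
  set S := P /ₘ (X - C u) with hS
  set R := S /ₘ (X - C u) with hR
  have hPS : C (P.eval u) + (X - C u) * S = P := by
    rw [← modByMonic_X_sub_C_eq_C_eval, modByMonic_add_div]
  have hSR : C (S.eval u) + (X - C u) * R = S := by
    rw [← modByMonic_X_sub_C_eq_C_eval, modByMonic_add_div]
  have hSu : S.eval u = P.derivative.eval u := by
    have h := congrArg (fun q : K[X] => q.derivative.eval u) hPS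
    simpa using h
  have hSdeg : S.natDegree = n := by
    rw [hS, natDegree_divByMonic _ (monic_X_sub_C u), hdeg, natDegree_X_sub_C]; rfl
  have hSlead : S.coeff n = 1 := by
    have h : S.leadingCoeff = 1 := by
      rw [hS, leadingCoeff_divByMonic_of_monic (monic_X_sub_C u), hP.leadingCoeff]
      rw [degree_X_sub_C, degree_eq_natDegree hP.ne_zero, hdeg]
      exact_mod_cast Nat.le_add_left 1 n
    rwa [leadingCoeff, hSdeg] at h
  have hS0 : S ≠ 0 := by
    intro h
    simp [h] at hSlead
  have hRlt : R.degree < n := by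
    rw [← hSdeg, ← degree_eq_natDegree hS0]
    exact degree_divByMonic_lt _ _ hS0 (by simp)
  refine ⟨C (P.derivative.eval u / P.eval u ^ 2) * S - C (P.eval u)⁻¹ * R, ?_, ?_, ?_⟩
  · refine Nat.lt_succ_of_le ((natDegree_sub_le _ _).trans (max_le ?_ ?_))
    · exact (natDegree_C_mul_le _ _).trans hSdeg.le
    · exact (natDegree_C_mul_le _ _).trans (natDegree_le_of_degree_le hRlt.le)
  · simp [hSlead, coeff_eq_zero_of_degree_lt hRlt]
  · intro x hx
    have hx0 : P.eval x = 0 := hx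
    have h₁ := congrArg (eval x) hPS
    have h₂ := congrArg (eval x) hSR
    simp only [eval_add, eval_mul, eval_sub, eval_X, eval_C, hx0, hSu] at h₁ h₂
    have hxu : x - u ≠ 0 := by
      intro h
      rw [h, zero_mul, add_zero] at h₁
      exact hu h₁
    simp only [eval_sub, eval_mul, eval_C]
    field_simp
    linear_combination (P.derivative.eval u * (x - u) - P.eval u) * h₁ -
      P.eval u * (x - u) * h₂

/-- for `r ≥ 1`, `a₁,…,a_r ∈ ℂ` and `u ∈ ℂ` with `u ≠ aᵢ` for all `i`,
the determinant of the `r×r` matrix with `i`-th row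
`(1/(aᵢ−u)², aᵢ^{r−2}, …, aᵢ, 1)` equals
`(−1)^{r−1} · ((∏_{j<k} (aⱼ − aₖ)) / (∏ᵢ (aᵢ − u))) · Σᵢ 1/(aᵢ − u)`. -/
theorem det_cauchy_sq_vandermonde_column (r : ℕ) (hr : 1 ≤ r) (a : Fin r → ℂ) (u : ℂ)
    (hu : ∀ i, u ≠ a i) :
    Matrix.det (Matrix.of fun i j : Fin r =>
        if (j : ℕ) = 0 then ((a i - u) ^ 2)⁻¹ else a i ^ (r - 1 - (j : ℕ))) =
      (-1 : ℂ) ^ (r - 1) *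
        ((∏ j : Fin r, ∏ k ∈ Finset.Ioi j, (a j - a k)) / ∏ i : Fin r, (a i - u)) *
        ∑ i : Fin r, (a i - u)⁻¹ := by
  obtain ⟨n, rfl⟩ := Nat.exists_eq_add_of_le' hr
  set P : Polynomial ℂ := ∏ i, (Polynomial.X - Polynomial.C (a i)) with hPdef
  have hD : ∏ i, (a i - u) ≠ 0 := Finset.prod_ne_zero_iff.2 fun i _ => sub_ne_zero.2 (hu i).symm
  have hPu : P.eval u = (-1) ^ (n + 1) * ∏ i, (a i - u) := by
    simp only [hPdef, Polynomial.eval_prod, Polynomial.eval_sub, Polynomial.eval_X,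
      Polynomial.eval_C]
    rw [← Finset.prod_congr rfl fun i _ => neg_sub (a i) u, Finset.prod_neg]
    simp
  have hPu0 : P.eval u ≠ 0 := by
    rw [hPu]
    exact mul_ne_zero (pow_ne_zero _ (by norm_num)) hD
  have hP' : P.derivative.eval u = -(P.eval u * ∑ i, (a i - u)⁻¹) := by
    rw [hPdef, Polynomial.derivative_prod_finset, Polynomial.eval_finsetSum, Finset.mul_sum,
      ← Finset.sum_neg_distrib]
    refine Finset.sum_congr rfl fun i hi => ?_
    rw [← Finset.mul_prod_erase _ _ hi]
    have := sub_ne_zero.2 (hu i).symm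
    simp only [Polynomial.derivative_X_sub_C, mul_one, Polynomial.eval_mul, Polynomial.eval_sub,
      Polynomial.eval_X, Polynomial.eval_C]
    field_simp
    ring
  obtain ⟨p, hpdeg, hpc, hp⟩ := exists_eval_eq_inv_sq_of_isRoot (n := n)
    (Polynomial.monic_prod_of_monic _ _ fun i _ => Polynomial.monic_X_sub_C (a i))
    (by simp [Polynomial.natDegree_prod_of_monic, Polynomial.monic_X_sub_C]) hPu0
  have hroot (i) : p.eval (a i) = ((a i - u) ^ 2)⁻¹ := hp _ <| by
    rw [Polynomial.IsRoot, Polynomial.eval_prod]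
    exact Finset.prod_eq_zero (Finset.mem_univ i) (by simp)
  have h := det_eval_vandermonde_column a p hpdeg
  simp only [hroot] at h
  rw [Nat.add_sub_cancel, h, hpc, ← hPdef, hP', hPu]
  have hsq : ((-1 : ℂ) ^ n) ^ 2 = 1 := by rw [← pow_mul, mul_comm, pow_mul]; simp
  field_simp
  rw [pow_succ]
  linear_combination ((∑ i, 1 / (a i - u)) *
    ∏ j, ∏ k ∈ Finset.Ioi j, (a j - a k)) * hsq
end

section
/- Let r ≥ 1 and s ≥ r−1 be integers and let a₁,…,a_r be elements of a commutative ring. Let M be the r×r matrix whose i-th row is (a_i^s, a_i^{r−2}, a_i^{r−3}, …, a_i, 1), i.e., M_{i,1} = a_i^s and M_{i,j} = a_i^{r−j} for 2 ≤ j ≤ r. Then det M = (∏_{1≤j<k≤r} (a_j − a_k)) · h_{s−r+1}(a₁,…,a_r), where h_m denotes the complete homogeneous symmetric polynomial of degree m in r variables (with h_0 = 1). -/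
open Finset

/-- The complete homogeneous symmetric polynomial of degree `m` evaluated at
`a₁,…,a_r`: the sum of all monomials of total degree `m` in the `aᵢ`. -/
def completeHomogeneous {R : Type*} [CommRing R] {r : ℕ} (m : ℕ) (a : Fin r → R) : R :=
  ∑ k ∈ Finset.Nat.antidiagonalTuple r m, ∏ i : Fin r, a i ^ k i

namespace completeHomogeneous

variable {R : Type*} [CommRing R] {r : ℕ}

theorem zero_right (a : Fin r → R) : completeHomogeneous 0 a = 1 := by
  simp [completeHomogeneous, Finset.Nat.antidiagonalTuple_zero_right]

theorem map_eq {S : Type*} [CommRing S] (f : R →+* S) (m : ℕ) (a : Fin r → R) :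
    f (completeHomogeneous m a) = completeHomogeneous m (f ∘ a) := by
  simp [completeHomogeneous]

theorem cons_eq_sum (m : ℕ) (x : R) (a : Fin r → R) :
    completeHomogeneous m (Fin.cons x a : Fin (r + 1) → R) =
      ∑ p ∈ Finset.HasAntidiagonal.antidiagonal m, x ^ p.1 * completeHomogeneous p.2 a := by
  simp only [completeHomogeneous, Finset.mul_sum]
  rw [Finset.sum_sigma']
  symm
  refine Finset.sum_bij' (fun q _ => (Fin.cons q.1.1 q.2 : Fin (r + 1) → ℕ))
    (fun k _ => ⟨(k 0, ∑ i, Fin.tail k i), Fin.tail k⟩) ?_ ?_ ?_ ?_ ?_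
  · rintro ⟨⟨i, j⟩, k⟩ h
    simp_all [Finset.Nat.mem_antidiagonalTuple, Fin.sum_univ_succ]
  · intro k h
    simp_all [Finset.Nat.mem_antidiagonalTuple, Fin.sum_univ_succ, Fin.tail]
  · rintro ⟨⟨i, j⟩, k⟩ h
    simp only [Finset.mem_sigma, Finset.Nat.mem_antidiagonalTuple] at h
    obtain ⟨-, rfl⟩ := h
    simp
  · intro k h
    simp
  · rintro ⟨⟨i, j⟩, k⟩ h
    simp [Fin.prod_univ_succ]

theorem cons_succ (m : ℕ) (x : R) (a : Fin r → R) :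
    completeHomogeneous (m + 1) (Fin.cons x a : Fin (r + 1) → R) =
      completeHomogeneous (m + 1) a +
        x * completeHomogeneous m (Fin.cons x a : Fin (r + 1) → R) := by
  rw [cons_eq_sum, cons_eq_sum, Finset.Nat.sum_antidiagonal_succ, Finset.mul_sum]
  simp [pow_succ', mul_assoc]

theorem cons_sub_cons (m : ℕ) (x y : R) (a : Fin r → R) :
    completeHomogeneous (m + 1) (Fin.cons x a : Fin (r + 1) → R) -
        completeHomogeneous (m + 1) (Fin.cons y a : Fin (r + 1) → R) =
      (x - y) * completeHomogeneous m
        (Fin.cons x (Fin.cons y a : Fin (r + 1) → R) : Fin (r + 2) → R) := by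
  induction m with
  | zero => simp only [cons_succ, zero_right]; ring
  | succ m ih =>
    rw [cons_succ m x (Fin.cons y a), cons_succ (m + 1) x, cons_succ (m + 1) y]
    linear_combination x * ih

end completeHomogeneous

open Polynomial in
/-- Newton interpolation of `X ^ (m + r)` at `r` nodes, with its leading coefficient and its
remainder term. -/
theorem exists_X_pow_eq_add_prod_mul_completeHomogeneous {R : Type*} [CommRing R] {r : ℕ}
    (a : Fin r → R) (m : ℕ) :
    ∃ p ∈ degreeLT R r, p.coeff (r - 1) = completeHomogeneous (m + 1) a ∧
      (X : R[X]) ^ (m + r) = p + (∏ i, (X - C (a i))) *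
        completeHomogeneous m (Fin.cons X (C ∘ a) : Fin (r + 1) → R[X]) := by
  induction r generalizing m with
  | zero => exact ⟨0, zero_mem _, by simp [completeHomogeneous], by simp [completeHomogeneous]⟩
  | succ r ih =>
    nontriviality R
    obtain ⟨p, hp, -, h⟩ := ih (Fin.tail a) (m + 1)
    set q : R[X] := ∏ i, (X - C (Fin.tail a i)) with hq
    have hqm : q.Monic := monic_prod_X_sub_C _ _
    have hqd : q.natDegree = r := by simp [hq]
    refine ⟨p + q * C (completeHomogeneous (m + 1) a), ?_, ?_, ?_⟩
    · refine add_mem (degreeLT_mono r.le_succ hp) (mem_degreeLT.2 ?_)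
      refine (degree_le_of_natDegree_le ((natDegree_mul_C_le _ _).trans hqd.le)).trans_lt ?_
      exact_mod_cast r.lt_succ_self
    · have hqc : q.coeff r = 1 := by simpa [hqd] using hqm.coeff_natDegree
      simp [hqc, coeff_eq_zero_of_degree_lt (mem_degreeLT.1 hp)]
    · have key := completeHomogeneous.cons_sub_cons m X (C (a 0)) (C ∘ Fin.tail a)
      have hc : (Fin.cons (C (a 0)) (C ∘ Fin.tail a) : Fin (r + 1) → R[X]) = C ∘ a := by
        ext i : 1
        refine Fin.cases ?_ (fun i => ?_) i <;> simp [Fin.tail]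
      rw [hc] at key
      rw [show m + (r + 1) = m + 1 + r by ring, h, completeHomogeneous.map_eq,
        Fin.prod_univ_succ]
      change _ = p + _ + (X - C (a 0)) * q * _
      linear_combination q * key

open Polynomial in
theorem exists_eval_eq_pow_and_coeff_eq_completeHomogeneous {R : Type*} [CommRing R] {r : ℕ}
    (a : Fin (r + 1) → R) (m : ℕ) :
    ∃ p ∈ degreeLT R (r + 1), p.coeff r = completeHomogeneous m a ∧
      ∀ i, p.eval (a i) = a i ^ (m + r) := by
  cases m with
  | zero =>
    refine ⟨X ^ r, mem_degreeLT.2 ((degree_X_pow_le r).trans_lt ?_), ?_, ?_⟩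
    · exact_mod_cast r.lt_succ_self
    · simp [completeHomogeneous.zero_right]
    · simp
  | succ m =>
    obtain ⟨p, hp, hc, h⟩ := exists_X_pow_eq_add_prod_mul_completeHomogeneous a m
    refine ⟨p, hp, hc, fun i => ?_⟩
    have hi := congrArg (eval (a i)) h
    rw [eval_add, eval_mul, eval_prod, Finset.prod_eq_zero (Finset.mem_univ i) (by simp)] at hi
    simpa [add_assoc, add_comm 1 r] using hi.symm

/-- for `r ≥ 1`, `s ≥ r−1` and elements `a₁,…,a_r` of a commutative
ring, the determinant of the `r×r` matrix with `i`-th row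
`(aᵢ^s, aᵢ^{r−2}, …, aᵢ, 1)` equals
`(∏_{j<k} (aⱼ − aₖ)) · h_{s−r+1}(a₁,…,a_r)`, where `h_m` is the complete
homogeneous symmetric polynomial of degree `m`. -/
theorem det_power_vandermonde_column {R : Type*} [CommRing R] (r s : ℕ)
    (hr : 1 ≤ r) (hs : r - 1 ≤ s) (a : Fin r → R) :
    Matrix.det (Matrix.of fun i j : Fin r =>
        if (j : ℕ) = 0 then a i ^ s else a i ^ (r - 1 - (j : ℕ))) =
      (∏ j : Fin r, ∏ k ∈ Finset.Ioi j, (a j - a k)) *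
        completeHomogeneous (s + 1 - r) a := by
  obtain ⟨r, rfl⟩ := Nat.exists_eq_add_of_le' hr
  obtain ⟨m, rfl⟩ := Nat.exists_eq_add_of_le' hs
  obtain ⟨p, hp, hc, he⟩ := exists_eval_eq_pow_and_coeff_eq_completeHomogeneous a m
  have hdet := Matrix.det_updateCol_sum (Matrix.projVandermonde 1 a) 0
    (fun k => p.coeff (Fin.rev k : Fin (r + 1)))
  rw [Matrix.det_projVandermonde] at hdet
  convert hdet using 1
  · congr 1
    ext i j
    refine Fin.cases ?_ (fun j => ?_) j
    · rw [Matrix.updateCol_self, ← Equiv.sum_comp Fin.revPerm]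
      simp [Matrix.projVandermonde_apply, ← he,
        Polynomial.eval_eq_sum_degreeLTEquiv hp, Polynomial.degreeLTEquiv]
    · rw [Matrix.updateCol_ne (Fin.succ_ne_zero j)]
      simp [Matrix.projVandermonde_apply, Fin.val_rev]
  · simp [hc, mul_comm]
end
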